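/- Let d ≥ 2, d < n−1, and let W and W' be snug partitions of the d-element subsets of [n−1] such that for some a_1 < a_2 < … < a_{d+2} in [n], W and W' have exactly the same blocks except that W contains the blocks r(a_1,…,â_i,…,a_{d+2}) (omitting a_i) for all i ∈ {1,…,d+2} with i ≢ d (mod 2), while W' instead contains the blocks r(a_1,…,â_i,…,a_{d+2}) for all i with i ≡ d (mod 2). Then there exists an admissible linear order on the (d+1)-element subsets of [n−1] in which both I(W') and I(W) occur as initial segments, where I(W) denotes the set of (d+1)-element subsets X = {x_1 < … < x_{d+1}} of [n−1] such that X∖{x_{d+1}} and X∖{x_d} lie in the same block of W. -/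

import Mathlib

/-- The snug rectangle `r(a₁,…,a_{k+1})`: all `k`-element subsets `{y₁<…<y_k}`
with `aᵢ ≤ yᵢ ≤ a_{i+1} - 1`. -/
def snugRect {k : ℕ} (a : Fin (k + 1) → ℕ) : Set (Finset ℕ) :=
  {Y | ∃ y : Fin k → ℕ,
    (∀ i : Fin k, a i.castSucc ≤ y i ∧ y i + 1 ≤ a i.succ) ∧
    Y = Finset.image y Finset.univ}

/-- `B` is a snug rectangle of `k`-subsets of `[n-1]`, with parameters in `[n]`. -/
def IsSnugRect (n k : ℕ) (B : Set (Finset ℕ)) : Prop :=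
  ∃ a : Fin (k + 1) → ℕ, StrictMono a ∧ (∀ i, 1 ≤ a i ∧ a i ≤ n) ∧ B = snugRect a

/-- A snug partition of the `k`-element subsets of `[n-1] = {1,…,n-1}`. -/
def SnugPartition (n k : ℕ) (W : Set (Set (Finset ℕ))) : Prop :=
  (∀ B ∈ W, IsSnugRect n k B) ∧
  ∀ Y : Finset ℕ, Y ⊆ Finset.Icc 1 (n - 1) → Y.card = k →
    ∃! B, B ∈ W ∧ Y ∈ B

/-- `Y` and `Z` lie in a common block of `W`. -/
def SameBlock (W : Set (Set (Finset ℕ))) (Y Z : Finset ℕ) : Prop :=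
  ∃ B ∈ W, Y ∈ B ∧ Z ∈ B

/-- The inversion set of a snug partition `W`: the `(d+1)`-element subsets
`X = {x₁<…<x_{d+1}}` of `[n-1]` such that `X \ {x_{d+1}}` and `X \ {x_d}`
(erase the largest, resp. second largest, element) lie in the same block. -/
def InvSetP (n d : ℕ) (W : Set (Set (Finset ℕ))) : Set (Finset ℕ) :=
  {X | X ⊆ Finset.Icc 1 (n - 1) ∧ X.card = d + 1 ∧
    SameBlock W (X.erase (X.sup id)) (X.erase ((X.erase (X.sup id)).sup id))}

/-- The list of parameters `a₁ < … < a_{d+2}` (1-based, given by `a`) with the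
`i`-th one omitted: `a₁, …, â_i, …, a_{d+2}`. -/
def aOmit (d : ℕ) (a : ℕ → ℕ) (i : ℕ) : Fin (d + 1) → ℕ :=
  fun k => if k.val + 1 < i then a (k.val + 1) else a (k.val + 2)

/-- Lexicographic comparison of finite sets via their increasingly sorted lists. -/
def lexLtN (A B : Finset ℕ) : Prop :=
  List.Lex (· < ·) (A.sort (· ≤ ·)) (B.sort (· ≤ ·))

/-- A ranking function `rank` (modelling a linear order on the `(d+1)`-element
subsets of `[n-1]`) is admissible if every `(d+1)`-packet occurs in lexicographic
order or in reverse lexicographic order. -/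
def AdmissibleN (n d : ℕ) (rank : Finset ℕ → ℕ) : Prop :=
  ∀ J : Finset ℕ, J ⊆ Finset.Icc 1 (n - 1) → J.card = d + 2 →
    (∀ Y, Y ⊆ J → Y.card = d + 1 → ∀ Z, Z ⊆ J → Z.card = d + 1 →
      lexLtN Y Z → rank Y < rank Z) ∨
    (∀ Y, Y ⊆ J → Y.card = d + 1 → ∀ Z, Z ⊆ J → Z.card = d + 1 →
      lexLtN Y Z → rank Z < rank Y)


def skp (k i : ℕ) : ℕ := if i < k then i else i + 1

def VV (N k : ℕ) (y : ℕ → ℕ) : Prop :=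
  (∀ i j, 1 ≤ i → i < j → j ≤ k → y i < y j) ∧ ∀ i, 1 ≤ i → i ≤ k → 1 ≤ y i ∧ y i ≤ N

structure Sys (N d : ℕ) (Φ : (ℕ → ℕ) → ℕ → ℕ) : Prop where
  mono : ∀ y, VV N d y → Monotone (Φ y)
  val : ∀ y, VV N d y → ∀ k, 1 ≤ k → k ≤ d → Φ y (y k) = k
  eq : ∀ y z, VV N d y → VV N d z → (∀ k, 1 ≤ k → k ≤ d → Φ y (z k) = k) → Φ y = Φ z

def Adj (Φ : (ℕ → ℕ) → ℕ → ℕ) (x : ℕ → ℕ) (k : ℕ) : Prop :=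
  Φ (x ∘ skp k) = Φ (x ∘ skp (k + 1))

theorem VV_skp {N k : ℕ} {x : ℕ → ℕ} (h : VV N (k + 1) x) (m : ℕ) : VV N k (x ∘ skp m) := by
  constructor
  · intro i j h1 h2 h3
    simp only [Function.comp, skp]
    split_ifs <;> apply h.1 <;> omega
  · intro i h1 h2
    simp only [Function.comp, skp]
    split_ifs <;> apply h.2 <;> omega

section
variable {N d : ℕ} {Φ : (ℕ → ℕ) → ℕ → ℕ}

theorem adj1 (S : Sys N d Φ) {x : ℕ → ℕ} (h : VV N (d + 1) x) {k : ℕ} (h1 : 1 ≤ k) (h2 : k ≤ d) :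
    Φ (x ∘ skp k) (x k) = k ↔ Adj Φ x k := by
  have vk := VV_skp h k
  have vk1 := VV_skp h (k + 1)
  constructor
  · intro e
    apply S.eq _ _ vk vk1
    intro i hi1 hi2
    have := S.val _ vk i hi1 hi2
    simp only [Function.comp_apply, skp] at this ⊢
    rcases lt_trichotomy i k with hh | hh | hh
    · rw [if_pos (by omega)] at this ⊢; exact this
    · subst hh; rw [if_pos (by omega)]; exact e
    · rw [if_neg (by omega)] at this ⊢; exact this
  · intro e
    rw [e]
    have := S.val _ vk1 k h1 h2
    simpa [skp] using this

theorem adj2 (S : Sys N d Φ) {x : ℕ → ℕ} (h : VV N (d + 1) x) {k : ℕ} (h1 : 1 ≤ k) (h2 : k ≤ d) :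
    Φ (x ∘ skp (k + 1)) (x (k + 1)) = k ↔ Adj Φ x k := by
  have vk := VV_skp h k
  have vk1 := VV_skp h (k + 1)
  constructor
  · intro e
    refine (S.eq _ _ vk1 vk ?_).symm
    intro i hi1 hi2
    have := S.val _ vk1 i hi1 hi2
    simp only [Function.comp_apply, skp] at this ⊢
    rcases lt_trichotomy i k with hh | hh | hh
    · rw [if_pos (by omega)] at this ⊢; exact this
    · subst hh; rw [if_neg (by omega)]; exact e
    · rw [if_neg (by omega)] at this ⊢; exact this
  · intro e
    rw [← e]
    have := S.val _ vk k h1 h2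
    simpa [skp] using this

theorem adj_xor (S : Sys N d Φ) {x : ℕ → ℕ} (h : VV N (d + 1) x) {k : ℕ} (h1 : 1 ≤ k)
    (h2 : k + 1 ≤ d) : Adj Φ x k ↔ ¬ Adj Φ x (k + 1) := by
  rw [← adj2 S h h1 (by omega), ← adj1 S h (by omega) h2]
  have v := VV_skp h (k + 1)
  have m1 := S.mono _ v (h.1 k (k+1) h1 (by omega) (by omega)).le
  have m2 := S.mono _ v (h.1 (k+1) (k+2) (by omega) (by omega) (by omega)).le
  have e1 := S.val _ v k h1 (by omega)
  have e2 := S.val _ v (k+1) (by omega) h2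
  simp only [Function.comp_apply, skp] at e1 e2
  rw [if_pos (by omega)] at e1
  rw [if_neg (by omega)] at e2
  change Φ (x ∘ skp (k+1)) (x k) = k at e1
  change Φ (x ∘ skp (k+1)) (x (k + 2)) = k + 1 at e2
  omega

theorem adj_par (S : Sys N d Φ) {x : ℕ → ℕ} (h : VV N (d + 1) x) {k : ℕ} (h1 : 1 ≤ k)
    (h2 : k ≤ d) : Adj Φ x k ↔ (Adj Φ x d ↔ Even (d + k)) := by
  obtain ⟨i, hi⟩ := Nat.exists_eq_add_of_le h2
  induction i generalizing k with
  | zero =>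
    have : k = d := by omega
    subst this; simp
  | succ i ih =>
    rw [adj_xor S h h1 (by omega), ih (by omega) (by omega) (by omega), ← add_assoc, Nat.even_add_one]
    tauto

theorem skp_comm {u v : ℕ} (h : u ≤ v) : skp (v+1) ∘ skp u = skp u ∘ skp v := by
  funext i; simp only [Function.comp_apply, skp]; split_ifs <;> omega

/-- block function after deletion of `u < v` -/
def bet (Φ : (ℕ → ℕ) → ℕ → ℕ) (j : ℕ → ℕ) (u v : ℕ) : ℕ → ℕ := Φ ((j ∘ skp v) ∘ skp u)

theorem bet_comm (Φ : (ℕ → ℕ) → ℕ → ℕ) (j : ℕ → ℕ) {u v : ℕ} (h : u ≤ v) :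
    bet Φ j u (v+1) = Φ ((j ∘ skp u) ∘ skp v) := by
  unfold bet
  rw [Function.comp_assoc, skp_comm h, Function.comp_assoc]

def ff (d : ℕ) (Φ : (ℕ → ℕ) → ℕ → ℕ) (j : ℕ → ℕ) (v : ℕ) : Prop := Adj Φ (j ∘ skp v) d

theorem F1 (S : Sys N d Φ) {j : ℕ → ℕ} (h : VV N (d + 2) j) {u v : ℕ} (huv : u < v)
    (h1 : 1 ≤ u) (h2 : u ≤ d) : bet Φ j u v (j u) = u ↔ (ff d Φ j v ↔ Even (d + u)) := by
  unfold ff bet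
  rw [← adj_par S (VV_skp h v) h1 h2, ← adj1 S (VV_skp h v) h1 h2]
  simp [skp, huv]

theorem F1' (S : Sys N d Φ) {j : ℕ → ℕ} (h : VV N (d + 2) j) {u v : ℕ} (huv : u + 1 < v)
    (h1 : 1 ≤ u) (h2 : u ≤ d) : bet Φ j (u+1) v (j (u+1)) = u ↔ (ff d Φ j v ↔ Even (d + u)) := by
  unfold ff bet
  rw [← adj_par S (VV_skp h v) h1 h2, ← adj2 S (VV_skp h v) h1 h2]
  simp [skp, huv]

theorem F2 (S : Sys N d Φ) {j : ℕ → ℕ} (h : VV N (d + 2) j) {u v : ℕ} (huv : u ≤ v)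
    (h1 : 1 ≤ v) (h2 : v ≤ d) : bet Φ j u (v+1) (j (v+1)) = v ↔ (ff d Φ j u ↔ Even (d + v)) := by
  unfold ff
  rw [bet_comm _ _ huv]
  rw [← adj_par S (VV_skp h u) h1 h2, ← adj1 S (VV_skp h u) h1 h2]
  have : skp u v = v + 1 := by simp [skp]; omega
  simp [this]

theorem F2' (S : Sys N d Φ) {j : ℕ → ℕ} (h : VV N (d + 2) j) {u v : ℕ} (huv : u ≤ v + 1)
    (h1 : 1 ≤ v) (h2 : v ≤ d) : bet Φ j u (v+2) (j (v+2)) = v ↔ (ff d Φ j u ↔ Even (d + v)) := by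
  unfold ff
  rw [bet_comm _ _ huv]
  rw [← adj_par S (VV_skp h u) h1 h2, ← adj2 S (VV_skp h u) h1 h2]
  have : skp u (v+1) = v + 2 := by simp [skp]; omega
  simp [this]

theorem bet_mono (S : Sys N d Φ) {j : ℕ → ℕ} (h : VV N (d + 2) j) (u v : ℕ) :
    Monotone (bet Φ j u v) := S.mono _ (VV_skp (VV_skp h v) u)

theorem bet_val (S : Sys N d Φ) {j : ℕ → ℕ} (h : VV N (d + 2) j) (u v : ℕ) {k : ℕ}
    (h1 : 1 ≤ k) (h2 : k ≤ d) : bet Φ j u v (j (skp v (skp u k))) = k :=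
  S.val _ (VV_skp (VV_skp h v) u) k h1 h2

theorem bet_eq (S : Sys N d Φ) {j : ℕ → ℕ} (h : VV N (d + 2) j) (u v u' v' : ℕ)
    (e : ∀ k, 1 ≤ k → k ≤ d → bet Φ j u v (j (skp v' (skp u' k))) = k) :
    bet Φ j u v = bet Φ j u' v' :=
  S.eq _ _ (VV_skp (VV_skp h v) u) (VV_skp (VV_skp h v') u') e

/-- sliding the first deleted element -/
theorem bet_slide (S : Sys N d Φ) {j : ℕ → ℕ} (h : VV N (d + 2) j) {p s : ℕ} (hp : 1 ≤ p)
    (hs : p + 2 ≤ s) (e : bet Φ j (p+1) s (j (p+1)) = p) :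
    bet Φ j (p+1) s = bet Φ j p s := by
  apply bet_eq S h
  intro k h1 h2
  have := bet_val S h (p+1) s h1 h2
  rcases eq_or_ne k p with hh | hh
  · subst hh
    have : skp s (skp k k) = k + 1 := by simp [skp]; omega
    rw [this, e]
  · have e2 : skp s (skp p k) = skp s (skp (p+1) k) := by
      simp only [skp]; split_ifs <;> omega
    rw [e2, this]

theorem L1 (S : Sys N d Φ) (hd : 2 ≤ d) {j : ℕ → ℕ} (h : VV N (d + 2) j) {p : ℕ} (hp : 1 ≤ p)
    (hpd : p ≤ d) (hne : ¬ (ff d Φ j p ↔ ff d Φ j (p+1))) : (ff d Φ j p ↔ Even (d + p)) := by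
  rcases eq_or_lt_of_le hp with h1 | h1
  · subst h1
    by_cases c : bet Φ j 2 3 (j 3) = 2
    · rw [F2 S h (by omega) (by omega) hd] at c
      rw [show d + 2 = (d + 1) + 1 by omega, Nat.even_add_one] at c
      simp only [Nat.reduceAdd] at hne
      tauto
    · have v1 := bet_val S h 2 3 (k := 1) (by omega) (by omega)
      have v2 := bet_val S h 2 3 (k := 2) (by omega) (by omega)
      norm_num [skp] at v1 v2
      have m1 := bet_mono S h 2 3 (h.1 1 2 (by omega) (by omega) (by omega)).le
      have m2 := bet_mono S h 2 3 (h.1 2 3 (by omega) (by omega) (by omega)).le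
      have m3 := bet_mono S h 2 3 (h.1 3 4 (by omega) (by omega) (by omega)).le
      have e2 : bet Φ j 2 3 (j 2) = 1 := by omega
      have e3 : bet Φ j 2 3 (j 3) = 1 := by omega
      have e : bet Φ j 2 3 = bet Φ j 1 2 := by
        apply bet_eq S h
        intro k h1 h2
        have := bet_val S h 2 3 h1 h2
        rcases eq_or_ne k 1 with hh | hh
        · subst hh; simpa [skp] using e3
        · have e4 : skp 2 (skp 1 k) = skp 3 (skp 2 k) := by
            simp only [skp]; split_ifs <;> omega
          rw [e4, this]
      rw [e] at e2
      exact (F2 S h (u := 1) (v := 1) le_rfl le_rfl (by omega)).1 e2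
  · by_contra hc
    obtain ⟨q, rfl⟩ : ∃ q, p = q + 1 := ⟨p - 1, by omega⟩
    have c1 := F1' S h (u := q) (v := q+2) (by omega) (by omega) (by omega)
    have c2 := F2 S h (u := q+1) (v := q+1) (by omega) (by omega) (by omega)
    have v1 := bet_val S h (q+1) (q+2) (k := q) (by omega) (by omega)
    have v2 := bet_val S h (q+1) (q+2) (k := q+1) (by omega) (by omega)
    rw [show skp (q+2) (skp (q+1) q) = q by simp [skp]] at v1
    rw [show skp (q+2) (skp (q+1) (q+1)) = q+3 by simp [skp]] at v2
    have m1 := bet_mono S h (q+1) (q+2) (h.1 q (q+1) (by omega) (by omega) (by omega)).le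
    have m2 := bet_mono S h (q+1) (q+2) (h.1 (q+1) (q+2) (by omega) (by omega) (by omega)).le
    have m3 := bet_mono S h (q+1) (q+2) (h.1 (q+2) (q+3) (by omega) (by omega) (by omega)).le
    rw [← add_assoc, Nat.even_add_one] at hc c2
    have n1 : bet Φ j (q+1) (q+2) (j (q+1)) ≠ q := by
      intro hh; have := c1.1 hh; tauto
    have n2 : bet Φ j (q+1) (q+2) (j (q+2)) ≠ q + 1 := by
      intro hh; have := c2.1 hh; tauto
    omega

theorem L2 (S : Sys N d Φ) (hd : 2 ≤ d) {j : ℕ → ℕ} (h : VV N (d + 2) j) {p s : ℕ} (hp : 1 ≤ p)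
    (hs : p + 2 ≤ s) (hsd : s ≤ d + 2) (hne : ¬ (ff d Φ j p ↔ ff d Φ j (p+1))) :
    ff d Φ j s ↔ ff d Φ j (p+1) := by
  by_contra hc
  have l1 := L1 S hd h hp (by omega) hne
  have hh := (F1' S h (u := p) (v := s) (by omega) hp (by omega)).2 (by tauto)
  have e := bet_slide S h hp hs hh
  obtain ⟨t, rfl⟩ : ∃ t, s = t + 2 := ⟨s - 2, by omega⟩
  have a1 := F2' S h (u := p+1) (v := t) (by omega) (by omega) (by omega)
  have a2 := F2' S h (u := p) (v := t) (by omega) (by omega) (by omega)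
  rw [e] at a1
  tauto

theorem ff_cons (S : Sys N d Φ) (hd : 2 ≤ d) {j : ℕ → ℕ} (h : VV N (d + 2) j) {p q s : ℕ}
    (hp : 1 ≤ p) (hpq : p < q) (hqs : q < s) (hsd : s ≤ d + 2) :
    ¬ ((ff d Φ j p ↔ ff d Φ j s) ∧ ¬ (ff d Φ j q ↔ ff d Φ j p)) := by
  rintro ⟨h1, h2⟩
  -- find the last index before q having the value of p
  have key : ∀ i, p + i ≤ q → (ff d Φ j (p + i) ↔ ff d Φ j p) := by
    intro i
    induction i with
    | zero => simp
    | succ i ih =>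
      intro hi
      have := ih (by omega)
      by_contra hc
      have l := L2 S hd h (p := p + i) (s := s) (by omega) (by omega) hsd (by
        rw [add_assoc]; tauto)
      rw [add_assoc] at l
      tauto
  have := key (q - p) (by omega)
  rw [show p + (q - p) = q by omega] at this
  exact h2 this
end

structure DSys (N d : ℕ) (Φ Φ' : (ℕ → ℕ) → ℕ → ℕ) (α : ℕ → ℕ) : Prop where
  mono : Monotone α
  g2 : ∀ y, VV N d y → ¬ ((∀ k, 1 ≤ k → k ≤ d → 1 ≤ α (y k) ∧ α (y k) ≤ d + 1) ∧
    ∀ i j, 1 ≤ i → i < j → j ≤ d → α (y i) < α (y j)) → Φ y = Φ' y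
  g1 : ∀ y, VV N d y → (∀ k, 1 ≤ k → k ≤ d → 1 ≤ α (y k) ∧ α (y k) ≤ d + 1) →
    (∀ i j, 1 ≤ i → i < j → j ≤ d → α (y i) < α (y j)) →
    ∀ p q, α p = α q → Φ y p = Φ y q ∧ Φ' y p = Φ' y q
  g3 : ∀ y, VV N d y → (∀ k, 1 ≤ k → k ≤ d → α (y k) = k) → ∀ p, α p = d + 1 →
    Φ y p = d ∧ Φ' y p = d + 1

def InD (d : ℕ) (α : ℕ → ℕ) (x : ℕ → ℕ) : Prop := ∀ k, 1 ≤ k → k ≤ d + 1 → α (x k) = k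

section
variable {N d : ℕ} {Φ Φ' : (ℕ → ℕ) → ℕ → ℕ} {α : ℕ → ℕ}

theorem D1 (S : Sys N d Φ) (S' : Sys N d Φ') (G : DSys N d Φ Φ' α) (hd : 1 ≤ d)
    {x : ℕ → ℕ} (h : VV N (d + 1) x) (hx : InD d α x) : Adj Φ x d ∧ ¬ Adj Φ' x d := by
  rw [← adj2 S h hd le_rfl, ← adj2 S' h hd le_rfl]
  have := G.g3 _ (VV_skp h (d+1)) (by
    intro k h1 h2
    have : skp (d+1) k = k := by simp [skp]; omega
    simp only [Function.comp_apply, this]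
    exact hx k h1 (by omega)) (x (d+1)) (hx _ (by omega) le_rfl)
  omega

theorem rank_lem {d : ℕ} {g : ℕ → ℕ} (h1 : 1 ≤ g 1)
    (h2 : ∀ k, 1 ≤ k → k < d → g k < g (k+1)) : ∀ k, 1 ≤ k → k ≤ d → k ≤ g k := by
  intro k hk
  induction k, hk using Nat.le_induction with
  | base => intro _; exact h1
  | succ k hk ih => intro h; have := ih (by omega); have := h2 k hk (by omega); omega

theorem rank_lem2 {d e : ℕ} {g : ℕ → ℕ} (h1 : g d ≤ d + e)
    (h2 : ∀ k, 1 ≤ k → k < d → g k < g (k+1)) : ∀ k, 1 ≤ k → k ≤ d → g k ≤ k + e := by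
  intro k hk hkd
  obtain ⟨i, hi⟩ := Nat.exists_eq_add_of_le hkd
  induction i generalizing k with
  | zero => have : k = d := by omega
            subst this; exact h1
  | succ i ih => have := ih (k+1) (by omega) (by omega) (by omega)
                 have := h2 k hk (by omega); omega

theorem D1' (S : Sys N d Φ) (S' : Sys N d Φ') (G : DSys N d Φ Φ' α) (hd : 1 ≤ d)
    {x : ℕ → ℕ} (h : VV N (d + 1) x) (hx : ¬ InD d α x) : Adj Φ x d ↔ Adj Φ' x d := by
  by_cases c1 : Φ (x ∘ skp d) = Φ' (x ∘ skp d)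
  · rw [← adj1 S h hd le_rfl, ← adj1 S' h hd le_rfl, c1]
  by_cases c2 : Φ (x ∘ skp (d+1)) = Φ' (x ∘ skp (d+1))
  · rw [← adj2 S h hd le_rfl, ← adj2 S' h hd le_rfl, c2]
  have r1 := not_imp_comm.1 (G.g2 _ (VV_skp h d)) c1
  have r2 := not_imp_comm.1 (G.g2 _ (VV_skp h (d+1))) c2
  have sk : ∀ k, k ≤ d → skp (d+1) k = k := by intro k hk; simp [skp]; omega
  have sk' : ∀ k, k < d → skp d k = k := by intro k hk; simp [skp]; omega
  have sk2 : skp d d = d + 1 := by simp [skp]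
  rcases eq_or_ne (α (x d)) (α (x (d+1))) with e | e
  · have := G.g1 _ (VV_skp h (d+1)) r2.1 r2.2 _ _ e
    have v := S.val _ (VV_skp h (d+1)) d hd le_rfl
    have v' := S'.val _ (VV_skp h (d+1)) d hd le_rfl
    simp only [Function.comp_apply, sk d le_rfl] at v v'
    rw [← adj2 S h hd le_rfl, ← adj2 S' h hd le_rfl]
    rw [this.1] at v
    rw [this.2] at v'
    tauto
  · exfalso; apply hx
    have lt := G.mono (h.1 d (d+1) hd (by omega) le_rfl).le
    have b1 := (r1.1 d hd le_rfl).2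
    rw [Function.comp_apply, sk2] at b1
    have st : ∀ k, 1 ≤ k → k < d + 1 → α (x k) < α (x (k+1)) := by
      intro k h1 h2
      rcases eq_or_ne k d with hh | hh
      · subst hh; omega
      · have := r2.2 k (k+1) h1 (by omega) (by omega)
        simpa [sk k (by omega), sk (k+1) (by omega)] using this
    intro k h1 h2
    have b2 := (r2.1 1 (by omega) hd).1
    rw [Function.comp_apply, sk 1 hd] at b2
    have a1 := rank_lem (g := fun k => α (x k)) (d := d+1) b2 st k h1 h2
    have a2 := rank_lem2 (g := fun k => α (x k)) (d := d+1) (e := 0) b1 st k h1 h2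
    omega

theorem D2 {j : ℕ → ℕ} {u v : ℕ} (hu : 1 ≤ u) (huv : u < v)
    (hv : v ≤ d + 2) (h1 : InD d α (j ∘ skp u)) (h2 : InD d α (j ∘ skp v)) :
    v = u + 1 ∧ ∀ m, 1 ≤ m → m ≤ d + 2 → α (j m) = if m ≤ u then m else m - 1 := by
  have e : v = u + 1 := by
    by_contra hne
    have a1 := h1 u hu (by omega)
    have a2 := h2 (u+1) (by omega) (by omega)
    simp only [Function.comp_apply, skp] at a1 a2
    rw [if_neg (by omega)] at a1
    rw [if_pos (by omega)] at a2
    omega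
  refine ⟨e, ?_⟩
  subst e
  intro m hm1 hm2
  split_ifs with hh
  · have := h2 m hm1 (by omega)
    simp only [Function.comp_apply, skp] at this
    rwa [if_pos (by omega)] at this
  · have := h1 (m-1) (by omega) (by omega)
    simp only [Function.comp_apply, skp] at this
    rwa [if_neg (by omega), show m - 1 + 1 = m by omega] at this

theorem D3 (S : Sys N d Φ) (G : DSys N d Φ Φ' α) 
    {j : ℕ → ℕ} (h : VV N (d + 2) j) {u k : ℕ} (hu : 1 ≤ u) (huk : u + 1 < k) (hk : k ≤ d + 2)
    (e : ∀ m, 1 ≤ m → m ≤ d + 2 → α (j m) = if m ≤ u then m else m - 1) :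
    ff d Φ j k ↔ Even (d + u) := by
  rw [← F1 S h (by omega : u < k) hu (by omega)]
  have := G.g1 _ (VV_skp (VV_skp h k) u) (by
    intro i i1 i2
    simp only [Function.comp_apply]
    have : 1 ≤ skp k (skp u i) ∧ skp k (skp u i) ≤ d + 2 := by
      simp only [skp]; split_ifs <;> omega
    rw [e _ this.1 this.2]
    simp only [skp]; split_ifs <;> omega) (by
    intro i i' i1 i2 i3
    simp only [Function.comp_apply]
    rw [e _ (by simp only [skp]; split_ifs <;> omega) (by simp only [skp]; split_ifs <;> omega),
      e _ (by simp only [skp]; split_ifs <;> omega) (by simp only [skp]; split_ifs <;> omega)]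
    simp only [skp]; split_ifs <;> omega) (j u) (j (u+1)) (by
      rw [e u (by omega) (by omega), e (u+1) (by omega) (by omega)]; simp)
  have v := bet_val S h u k hu (by omega)
  rw [show skp k (skp u u) = u + 1 by simp [skp]; omega] at v
  unfold bet at v ⊢
  rw [this.1, v]

theorem D4 (S : Sys N d Φ) (G : DSys N d Φ Φ' α) 
    {j : ℕ → ℕ} (h : VV N (d + 2) j) {u k : ℕ} (hu : 1 ≤ k) (huk : k < u) (hk : u + 1 ≤ d + 2)
    (e : ∀ m, 1 ≤ m → m ≤ d + 2 → α (j m) = if m ≤ u then m else m - 1) :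
    ff d Φ j k ↔ ¬ Even (d + u) := by
  obtain ⟨t, rfl⟩ : ∃ t, u = t + 1 := ⟨u - 1, by omega⟩
  rw [← add_assoc, Nat.even_add_one, not_not, ← F2' S h (by omega : k ≤ t + 1) (by omega) (by omega)]
  have := G.g1 _ (VV_skp (VV_skp h (t+2)) k) (by
    intro i i1 i2
    simp only [Function.comp_apply]
    have : 1 ≤ skp (t+2) (skp k i) ∧ skp (t+2) (skp k i) ≤ d + 2 := by
      simp only [skp]; split_ifs <;> omega
    rw [e _ this.1 this.2]
    simp only [skp]; split_ifs <;> omega) (by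
    intro i i' i1 i2 i3
    simp only [Function.comp_apply]
    rw [e _ (by simp only [skp]; split_ifs <;> omega) (by simp only [skp]; split_ifs <;> omega),
      e _ (by simp only [skp]; split_ifs <;> omega) (by simp only [skp]; split_ifs <;> omega)]
    simp only [skp]; split_ifs <;> omega) (j (t+1)) (j (t+2)) (by
      rw [e (t+1) (by omega) (by omega), e (t+2) (by omega) (by omega)]; simp)
  have v := bet_val S h k (t+2) (k := t) (by omega) (by omega)
  rw [show skp (t+2) (skp k t) = t + 1 by simp only [skp]; split_ifs <;> omega] at v
  unfold bet at v ⊢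
  rw [← this.1, v]
end


def Consis (m d : ℕ) (S : Finset ℕ → Prop) : Prop :=
  ∀ J : Finset ℕ, J ⊆ Finset.Icc 1 m → J.card = d + 2 → ∀ x ∈ J, ∀ y ∈ J, ∀ z ∈ J,
    x < y → y < z →
    ¬ ((S (J.erase x) ↔ S (J.erase z)) ∧ ¬ (S (J.erase y) ↔ S (J.erase x)))

theorem bdd (m : ℕ) (r : Finset ℕ → ℕ) : ∃ M, ∀ X, X ⊆ Finset.Icc 1 m → r X < M :=
  ⟨(Finset.Icc 1 m).powerset.sup r + 1, fun _ hX =>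
    Nat.lt_succ_of_le (Finset.le_sup (f := r) (Finset.mem_powerset.2 hX))⟩

theorem sub_of_notMem {m : ℕ} {X : Finset ℕ} (h : X ⊆ Finset.Icc 1 (m+1)) (h' : m + 1 ∉ X) :
    X ⊆ Finset.Icc 1 m := by
  intro x hx
  have := Finset.mem_Icc.1 (h hx)
  have : x ≠ m + 1 := fun e => h' (e ▸ hx)
  rw [Finset.mem_Icc]; omega

theorem thmC (m : ℕ) : ∀ (d : ℕ) (S : Finset ℕ → Prop), Consis m d S →
    ∃ r : Finset ℕ → ℕ, ∀ X : Finset ℕ, X ⊆ Finset.Icc 1 m → X.card = d + 1 →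
      ∀ x ∈ X, ∀ y ∈ X, x < y →
        (S X → r (X.erase y) < r (X.erase x)) ∧ (¬ S X → r (X.erase x) < r (X.erase y)) := by
  classical
  induction m with
  | zero =>
    intro d S _
    refine ⟨fun _ => 0, ?_⟩
    intro X hX hc
    have : X = ∅ := by simpa using hX
    subst this; simp at hc
  | succ m ih =>
    intro d S hS
    rcases d with _ | d
    · refine ⟨fun _ => 0, ?_⟩
      intro X hX hc x hx y hy hxy
      have := Finset.card_le_one.1 (le_of_eq hc) x hx y hy
      omega
    have sub : Finset.Icc 1 m ⊆ Finset.Icc 1 (m+1) := Finset.Icc_subset_Icc le_rfl (by omega)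
    have ins : ∀ Z : Finset ℕ, Z ⊆ Finset.Icc 1 m → insert (m+1) Z ⊆ Finset.Icc 1 (m+1) := by
      intro Z hZ
      apply Finset.insert_subset (by simp) (hZ.trans sub)
    have nm : ∀ Z : Finset ℕ, Z ⊆ Finset.Icc 1 m → m + 1 ∉ Z := by
      intro Z hZ h
      have := Finset.mem_Icc.1 (hZ h); omega
    obtain ⟨r1, h1⟩ := ih (d+1) S (fun J hJ hc => hS J (hJ.trans sub) hc)
    obtain ⟨r2, h2⟩ := ih d (fun Z => S (insert (m+1) Z)) (by
      intro J hJ hc x hx y hy z hz hxy hyz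
      have := hS (insert (m+1) J) (ins J hJ) (by rw [Finset.card_insert_of_notMem (nm J hJ), hc])
        x (by simp [hx]) y (by simp [hy]) z (by simp [hz]) hxy hyz
      have ne : ∀ w ∈ J, m + 1 ≠ w := fun w hw e => nm J hJ (e ▸ hw)
      rwa [Finset.erase_insert_of_ne (ne x hx), Finset.erase_insert_of_ne (ne y hy),
        Finset.erase_insert_of_ne (ne z hz)] at this)
    obtain ⟨M1, hM1⟩ := bdd (m+1) r1
    obtain ⟨M2, hM2⟩ := bdd (m+1) r2
    refine ⟨fun Y => if m + 1 ∈ Y then M1 + r2 (Y.erase (m+1)) else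
      if S (insert (m+1) Y) then r1 Y else M1 + M2 + r1 Y, ?_⟩
    intro X hX hc x hx y hy hxy
    have er : ∀ w, X.erase w ⊆ Finset.Icc 1 (m+1) := fun w => (Finset.erase_subset _ _).trans hX
    by_cases hm : m + 1 ∈ X
    · rcases eq_or_ne y (m+1) with e | e
      · subst e
        have hne : ¬ (m + 1 = x) := by omega
        simp only [Finset.mem_erase, hm, Finset.insert_erase hm, ne_eq, not_true_eq_false,
          false_and, if_false, and_true, hne, not_false_eq_true, if_true]
        have a1 := hM1 _ (er (m+1))
        have a2 := hM2 _ ((Finset.erase_subset (m+1) _).trans (er x))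
        constructor
        · intro s; rw [if_pos s]; omega
        · intro s; rw [if_neg s]; omega
      · have hym : y ≤ m + 1 := (Finset.mem_Icc.1 (hX hy)).2
        have := h2 (X.erase (m+1)) (sub_of_notMem (er _) (by simp))
          (by rw [Finset.card_erase_of_mem hm, hc]; omega) x (by simp [hx]; omega) y (by simp [hy, e]) hxy
        rw [Finset.insert_erase hm] at this
        simp only [Finset.mem_erase, hm]
        rw [if_pos (by simp; omega), if_pos (by simp; omega)]
        rw [Finset.erase_right_comm (a := y), Finset.erase_right_comm (a := x)]
        constructor
        · intro s; have := this.1 s; omega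
        · intro s; have := this.2 s; omega
    · have hX' := sub_of_notMem hX hm
      have a := h1 X hX' hc x hx y hy hxy
      have hym : y ≤ m := (Finset.mem_Icc.1 (hX' hy)).2
      have c := hS (insert (m+1) X) (ins X hX') (by rw [Finset.card_insert_of_notMem hm, hc])
        x (by simp [hx]) y (by simp [hy]) (m+1) (by simp) hxy (by omega)
      rw [Finset.erase_insert hm, Finset.erase_insert_of_ne (by omega),
        Finset.erase_insert_of_ne (by omega)] at c
      simp only [Finset.mem_erase, hm, and_false, if_false]
      have a1 := hM1 _ (er x)
      have a2 := hM1 _ (er y)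
      constructor
      · intro s
        have := a.1 s
        split_ifs with c1 c2 c2
        · omega
        · omega
        · exfalso; tauto
        · omega
      · intro s
        have := a.2 s
        split_ifs with c1 c2 c2
        · omega
        · omega
        · exfalso; tauto
        · omega

def Orient (m d : ℕ) (r : Finset ℕ → ℕ) : Prop :=
  ∀ J : Finset ℕ, J ⊆ Finset.Icc 1 m → J.card = d + 2 →
    (∀ x ∈ J, ∀ y ∈ J, x < y → r (J.erase y) < r (J.erase x)) ∨
    (∀ x ∈ J, ∀ y ∈ J, x < y → r (J.erase x) < r (J.erase y))

theorem step2 (m d : ℕ) (S : Finset ℕ → Prop) (hS : Consis m d S) :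
    ∃ (r : Finset ℕ → ℕ) (M : ℕ), Orient m d r ∧
      ∀ X : Finset ℕ, X ⊆ Finset.Icc 1 m → X.card = d + 1 → (S X ↔ r X < M) := by
  classical
  have sup_eq : ∀ (J : Finset ℕ) (z : ℕ), z ∈ J → (∀ w ∈ J, w ≤ z) → J.sup id = z := by
    intro J z hz h
    exact le_antisymm (Finset.sup_le h) (Finset.le_sup (f := id) hz)
  have sup_mem : ∀ (J : Finset ℕ), J.Nonempty → J.sup id ∈ J := by
    intro J hJ
    obtain ⟨z, hz, h⟩ := J.exists_mem_eq_sup hJ id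
    rw [h]; exact hz
  have le_sup : ∀ (J : Finset ℕ), ∀ w ∈ J, w ≤ J.sup id := fun J w hw => Finset.le_sup (f := id) hw
  obtain ⟨r, hr⟩ := thmC m (d+1) (fun J => S (J.erase (J.sup id))) (by
    intro L hL hc x hx y hy z hz hxy hyz
    have ne : L.Nonempty := ⟨x, hx⟩
    set t := L.sup id with ht
    have htm := sup_mem L ne
    rw [← ht] at htm
    have hle := le_sup L
    rw [← ht] at hle
    have hs : ∀ w ∈ L, w ≠ t → (L.erase w).sup id = t := by
      intro w hw hwt
      apply sup_eq
      · simp [htm]; exact fun e => hwt e.symm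
      · intro v hv; exact hle v (Finset.mem_of_mem_erase hv)
    have hzt := hle z hz
    set J := L.erase t with hJ
    have hJs : J ⊆ Finset.Icc 1 m := (Finset.erase_subset _ _).trans hL
    have hJc : J.card = d + 2 := by rw [hJ, Finset.card_erase_of_mem htm, hc]; omega
    have hxJ : x ∈ J := by simp [hJ, hx]; omega
    have hyJ : y ∈ J := by simp [hJ, hy]; omega
    simp only []
    rw [hs x hx (by omega), hs y hy (by omega), Finset.erase_right_comm, ← hJ,
      Finset.erase_right_comm (a := y), ← hJ]
    by_cases e : z = t
    · rw [e, ← hJ]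
      set q := J.sup id with hq
      have hqJ : q ∈ J := sup_mem J ⟨x, hxJ⟩
      have hqle := le_sup J
      rw [← hq] at hqle
      rcases eq_or_lt_of_le (hqle y hyJ) with h | h
      · rw [← h]; tauto
      · exact hS J hJs hJc x hxJ y hyJ q hqJ hxy h
    · rw [hs z hz e, Finset.erase_right_comm (a := z), ← hJ]
      exact hS J hJs hJc x hxJ y hyJ z (by simp [hJ, hz, e]) hxy hyz)
  obtain ⟨M, hM⟩ := bdd m r
  refine ⟨fun X => if S X then r X else M + r X, M, ?_, ?_⟩
  · intro J hJ hc
    have ne : J.Nonempty := by rw [← Finset.card_pos]; omega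
    have er : ∀ w, J.erase w ⊆ Finset.Icc 1 m := fun w => (Finset.erase_subset _ _).trans hJ
    have key : ∀ x ∈ J, ∀ y ∈ J, x < y → y = J.sup id ∨ 
      ¬ ((S (J.erase x) ↔ S (J.erase (J.sup id))) ∧ ¬ (S (J.erase y) ↔ S (J.erase x))) := by
      intro x hx y hy hxy
      rcases eq_or_lt_of_le (le_sup J y hy) with h | h
      · left; exact h
      · right; exact hS J hJ hc x hx y hy _ (sup_mem J ne) hxy h
    by_cases c : S (J.erase (J.sup id))
    · left
      intro x hx y hy hxy
      have a := (hr J hJ hc x hx y hy hxy).1 c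
      have b1 := hM _ (er x)
      have b2 := hM _ (er y)
      simp only []
      split_ifs with c1 c2 c2
      · omega
      · omega
      · exfalso
        rcases key x hx y hy hxy with h | h
        · rw [h] at c1; tauto
        · tauto
      · omega
    · right
      intro x hx y hy hxy
      have a := (hr J hJ hc x hx y hy hxy).2 c
      have b1 := hM _ (er x)
      have b2 := hM _ (er y)
      simp only []
      split_ifs with c1 c2 c2
      · omega
      · omega
      · exfalso
        rcases key x hx y hy hxy with h | h
        · rw [h] at c2; tauto
        · tauto
      · omega
  · intro X hX hc
    have := hM X hX
    simp only []
    split_ifs with c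
    · tauto
    · simp [c]

theorem prefix_con {m d : ℕ} {r : Finset ℕ → ℕ} (h : Orient m d r) (t : ℕ) :
    Consis m d (fun X => r X < t) := by
  intro J hJ hc x hx y hy z hz hxy hyz
  rcases h J hJ hc with h | h
  · have := h x hx y hy hxy
    have := h y hy z hz hyz
    simp only []
    rintro ⟨h1, h2⟩
    omega
  · have := h x hx y hy hxy
    have := h y hy z hz hyz
    simp only []
    rintro ⟨h1, h2⟩
    omega

theorem orient_of_prefix {m d : ℕ} {r : Finset ℕ → ℕ}
    (hinj : ∀ J : Finset ℕ, J ⊆ Finset.Icc 1 m → J.card = d + 2 → ∀ x ∈ J, ∀ y ∈ J, x < y →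
      r (J.erase x) ≠ r (J.erase y))
    (h : ∀ t, Consis m d (fun X => r X < t)) : Orient m d r := by
  intro J hJ hc
  have bt : ∀ x ∈ J, ∀ y ∈ J, ∀ z ∈ J, x < y → y < z →
      (r (J.erase x) < r (J.erase y) ∧ r (J.erase y) < r (J.erase z)) ∨
      (r (J.erase z) < r (J.erase y) ∧ r (J.erase y) < r (J.erase x)) := by
    intro x hx y hy z hz hxy hyz
    have a1 := h (r (J.erase y)) J hJ hc x hx y hy z hz hxy hyz
    have a2 := h (r (J.erase y) + 1) J hJ hc x hx y hy z hz hxy hyz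
    have n1 := hinj J hJ hc x hx y hy hxy
    have n2 := hinj J hJ hc y hy z hz hyz
    simp only [] at a1 a2
    omega
  have ne : J.Nonempty := by rw [← Finset.card_pos]; omega
  set p := J.min' ne with hp
  have hpJ : p ∈ J := J.min'_mem ne
  set q := J.max' ne with hq
  have hqJ : q ∈ J := J.max'_mem ne
  have hpl : ∀ w ∈ J, p ≤ w := fun w hw => J.min'_le w hw
  have hql : ∀ w ∈ J, w ≤ q := fun w hw => J.le_max' w hw
  have hpq : p < q := by
    rcases eq_or_lt_of_le (hpl q hqJ) with e | e
    · exfalso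
      have : J.card ≤ 1 := Finset.card_le_one.2 (fun a ha b hb => by
        have := hpl a ha; have := hpl b hb; have := hql a ha; have := hql b hb; omega)
      omega
    · exact e
  have n0 := hinj J hJ hc p hpJ q hqJ hpq
  have first : ∀ l ∈ J, p < l → (r (J.erase p) < r (J.erase q) ↔ r (J.erase p) < r (J.erase l)) := by
    intro l hl hpl'
    rcases eq_or_lt_of_le (hql l hl) with e | e
    · rw [e]
    · have := bt p hpJ l hl q hqJ hpl' e
      omega
  rcases lt_or_gt_of_ne n0 with c | c
  · right
    intro x hx y hy hxy
    have f := (first y hy (lt_of_le_of_lt (hpl x hx) hxy)).1 c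
    rcases eq_or_lt_of_le (hpl x hx) with e | e
    · rw [← e]; exact f
    · have := bt p hpJ x hx y hy e hxy; omega
  · left
    intro x hx y hy hxy
    have f := first y hy (lt_of_le_of_lt (hpl x hx) hxy)
    have n := hinj J hJ hc p hpJ y hy (lt_of_le_of_lt (hpl x hx) hxy)
    rcases eq_or_lt_of_le (hpl x hx) with e | e
    · rw [← e]; omega
    · have := bt p hpJ x hx y hy e hxy; omega

theorem Consis.congr {m d : ℕ} {S T : Finset ℕ → Prop} (h : Consis m d S)
    (e : ∀ X : Finset ℕ, X ⊆ Finset.Icc 1 m → X.card = d + 1 → (T X ↔ S X)) : Consis m d T := by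
  intro J hJ hc x hx y hy z hz hxy hyz
  have k : ∀ w ∈ J, (T (J.erase w) ↔ S (J.erase w)) := by
    intro w hw
    apply e _ ((Finset.erase_subset _ _).trans hJ)
    rw [Finset.card_erase_of_mem hw, hc]; omega
  rw [k x hx, k y hy, k z hz]
  exact h J hJ hc x hx y hy z hz hxy hyz

theorem pl1 {A A' D P : Prop} (n : ¬ D → (A ↔ A')) (c : ¬ D) :
    ((A' ∨ (D ∧ P)) ↔ A) ∧ ((A' ∨ (D ∧ P)) ↔ A') := by
  have := n c
  tauto

theorem pl2 {A A' D P : Prop} (h : D → A ∧ ¬ A') (n : ¬ D → (A ↔ A')) :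
    ((A' ∨ (D ∧ P)) ↔ A) ∨ ((A' ∨ (D ∧ P)) ↔ A') := by
  by_cases c : D
  · have := h c
    by_cases p : P <;> tauto
  · exact Or.inl (pl1 n c).1

theorem combine (m d : ℕ) (S' S D : Finset ℕ → Prop) (w : ℕ → ℕ)
    (hS' : Consis m d S') (hS : Consis m d S)
    (hD : ∀ X : Finset ℕ, X ⊆ Finset.Icc 1 m → X.card = d + 1 → D X → S X ∧ ¬ S' X)
    (hnD : ∀ X : Finset ℕ, X ⊆ Finset.Icc 1 m → X.card = d + 1 → ¬ D X → (S X ↔ S' X))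
    (hw : ∀ J : Finset ℕ, J ⊆ Finset.Icc 1 m → J.card = d + 2 → ∀ u ∈ J, ∀ v ∈ J, u < v →
      D (J.erase u) → D (J.erase v) → w u ≠ w v ∧ ∀ k ∈ J, k ≠ u → k ≠ v →
        ¬ D (J.erase k) ∧ ((v < k ∧ (S (J.erase k) ↔ w u < w v)) ∨
          (k < u ∧ (S (J.erase k) ↔ w v < w u)))) :
    ∃ (r : Finset ℕ → ℕ) (M' M : ℕ), Orient m d r ∧
      ∀ X : Finset ℕ, X ⊆ Finset.Icc 1 m → X.card = d + 1 → (S' X ↔ r X < M') ∧ (S X ↔ r X < M) := by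
  classical
  obtain ⟨r', M', o', t'⟩ := step2 m d S' hS'
  obtain ⟨r, M, o, t⟩ := step2 m d S hS
  obtain ⟨B, hB⟩ := bdd m (fun X => ∑ x ∈ X, w x)
  set s : Finset ℕ → ℕ := fun X => ∑ x ∈ X, w x with hs
  have hse : ∀ (J : Finset ℕ), ∀ x ∈ J, s (J.erase x) + w x = s J := by
    intro J x hx; exact Finset.sum_erase_add J w hx
  set R : Finset ℕ → ℕ := fun X => if S' X then r' X else if D X then M' + s X else M' + B + r X
    with hR
  have R1 : ∀ X, S' X → R X = r' X := by intro X h; simp [hR, h]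
  have R2 : ∀ X : Finset ℕ, X ⊆ Finset.Icc 1 m → X.card = d + 1 → D X → R X = M' + s X := by
    intro X h1 h2 h; simp [hR, h, (hD X h1 h2 h).2]
  have R3 : ∀ X : Finset ℕ, X ⊆ Finset.Icc 1 m → X.card = d + 1 → ¬ S X → R X = M' + B + r X := by
    intro X h1 h2 h
    have a : ¬ D X := fun h' => h (hD X h1 h2 h').1
    have b : ¬ S' X := fun h' => h ((hnD X h1 h2 a).2 h')
    simp [hR, a, b]
  have cases3 : ∀ X : Finset ℕ, X ⊆ Finset.Icc 1 m → X.card = d + 1 →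
      (S' X ∧ S X ∧ ¬ D X ∧ R X = r' X ∧ r' X < M' ∧ r X < M) ∨
      (¬ S' X ∧ S X ∧ D X ∧ R X = M' + s X ∧ s X < B ∧ M' ≤ r' X ∧ r X < M) ∨
      (¬ S' X ∧ ¬ S X ∧ ¬ D X ∧ R X = M' + B + r X ∧ M' ≤ r' X ∧ M ≤ r X) := by
    intro X h1 h2
    have t1 := t X h1 h2
    have t2 := t' X h1 h2
    rw [← not_lt, ← not_lt, ← t1, ← t2]
    by_cases c : D X
    · have := hD X h1 h2 c
      have := R2 X h1 h2 c
      have := hB X h1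
      tauto
    · have := hnD X h1 h2 c
      by_cases c' : S X
      · have := R1 X; tauto
      · have := R3 X h1 h2; tauto
  have er : ∀ J : Finset ℕ, J ⊆ Finset.Icc 1 m → J.card = d + 2 → ∀ x ∈ J,
      J.erase x ⊆ Finset.Icc 1 m ∧ (J.erase x).card = d + 1 := by
    intro J hJ hc x hx
    refine ⟨(Finset.erase_subset _ _).trans hJ, ?_⟩
    rw [Finset.card_erase_of_mem hx, hc]; omega
  refine ⟨R, M', M' + B, ?_, ?_⟩
  · apply orient_of_prefix
    · intro J hJ hc x hx y hy hxy
      have ex := er J hJ hc x hx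
      have ey := er J hJ hc y hy
      have o1 := o J hJ hc
      have o2 := o' J hJ hc
      have n1 : r (J.erase x) ≠ r (J.erase y) := by
        rcases o1 with h | h
        · exact (h x hx y hy hxy).ne'
        · exact (h x hx y hy hxy).ne
      have n2 : r' (J.erase x) ≠ r' (J.erase y) := by
        rcases o2 with h | h
        · exact (h x hx y hy hxy).ne'
        · exact (h x hx y hy hxy).ne
      have sx := hse J x hx
      have sy := hse J y hy
      rcases cases3 _ ex.1 ex.2 with cx | cx | cx <;> rcases cases3 _ ey.1 ey.2 with cy | cy | cy
      all_goals try omega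
      have := (hw J hJ hc x hx y hy hxy cx.2.2.1 cy.2.2.1).1
      omega
    · intro τ
      by_cases h1 : τ ≤ M'
      · apply (prefix_con o' τ).congr
        intro X hX hc
        rcases cases3 X hX hc with c | c | c <;> omega
      by_cases h2 : M' + B ≤ τ
      · apply (prefix_con o (max (τ - M' - B) M)).congr
        intro X hX hc
        rcases cases3 X hX hc with c | c | c <;> omega
      obtain ⟨t, rfl⟩ : ∃ t, τ = M' + t := ⟨τ - M', by omega⟩
      have hT : Consis m d (fun X => S' X ∨ (D X ∧ s X < t)) := by
        intro J hJ hc x hx y hy z hz hxy hyz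
        have ex := er J hJ hc x hx
        have ey := er J hJ hc y hy
        have ez := er J hJ hc z hz
        have k1 := hS J hJ hc x hx y hy z hz hxy hyz
        have k2 := hS' J hJ hc x hx y hy z hz hxy hyz
        have sx := hse J x hx
        have sy := hse J y hy
        have sz := hse J z hz
        have dx := hD _ ex.1 ex.2
        have dy := hD _ ey.1 ey.2
        have dz := hD _ ez.1 ez.2
        have nx := hnD _ ex.1 ex.2
        have ny := hnD _ ey.1 ey.2
        have nz := hnD _ ez.1 ez.2
        simp only []
        by_cases cx : D (J.erase x) <;> by_cases cy : D (J.erase y)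
        · have q := hw J hJ hc x hx y hy hxy cx cy
          have q1 := q.2 z hz (by omega) (by omega)
          have q2 : S (J.erase z) ↔ w x < w y := by
            rcases q1.2 with h | h
            · exact h.2
            · omega
          have dx' := dx cx
          have dy' := dy cy
          have nz' := nz q1.1
          have q3 := q1.1
          simp only [cx, cy, q3, dx'.2, dy'.2, ← nz', q2]
          simp only [true_and, false_and, or_false, false_or]
          omega
        · by_cases cz : D (J.erase z)
          · have q := hw J hJ hc x hx z hz (by omega) cx cz
            have q1 := q.2 y hy (by omega) (by omega)
            omega
          · have py := pl1 (P := s (J.erase y) < t) ny cy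
            have pz := pl1 (P := s (J.erase z) < t) nz cz
            rcases pl2 (P := s (J.erase x) < t) dx nx with p | p
            · rw [p, py.1, pz.1]; exact k1
            · rw [p, py.2, pz.2]; exact k2
        · by_cases cz : D (J.erase z)
          · have q := hw J hJ hc y hy z hz hyz cy cz
            have q1 := q.2 x hx (by omega) (by omega)
            have q2 : S (J.erase x) ↔ w z < w y := by
              rcases q1.2 with h | h
              · omega
              · exact h.2
            have dz' := dz cz
            have dy' := dy cy
            have nx' := nx q1.1
            simp only [cx, cy, cz, dz'.2, dy'.2, ← nx', q2]
            simp only [true_and, false_and, or_false, false_or]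
            omega
          · have px := pl1 (P := s (J.erase x) < t) nx cx
            have pz := pl1 (P := s (J.erase z) < t) nz cz
            rcases pl2 (P := s (J.erase y) < t) dy ny with p | p
            · rw [p, px.1, pz.1]; exact k1
            · rw [p, px.2, pz.2]; exact k2
        · have px := pl1 (P := s (J.erase x) < t) nx cx
          have py := pl1 (P := s (J.erase y) < t) ny cy
          rcases pl2 (P := s (J.erase z) < t) dz nz with p | p
          · rw [p, px.1, py.1]; exact k1
          · rw [p, px.2, py.2]; exact k2
      apply hT.congr
      intro X hX hc
      rcases cases3 X hX hc with c | c | c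
      · have : R X < M' + t := by omega
        tauto
      · rw [c.2.2.2.1]
        have : M' + s X < M' + t ↔ s X < t := by omega
        tauto
      · have : ¬ R X < M' + t := by omega
        tauto
  · intro X hX hc
    rcases cases3 X hX hc with c | c | c
    · have : R X < M' := by omega
      have : R X < M' + B := by omega
      tauto
    · have : ¬ R X < M' := by omega
      have : R X < M' + B := by omega
      tauto
    · have : ¬ R X < M' := by omega
      have : ¬ R X < M' + B := by omega
      tauto


theorem lex_erase : ∀ (l : List ℕ), l.Pairwise (· < ·) → ∀ x ∈ l, ∀ y ∈ l, x < y →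
    List.Lex (· < ·) (l.erase y) (l.erase x) := by
  intro l
  induction l with
  | nil => intro _ x hx; simp at hx
  | cons b l ih =>
    intro hl x hx y hy hxy
    rw [List.pairwise_cons] at hl
    have hyb : y ≠ b := by
      rintro rfl
      rcases List.mem_cons.1 hx with h | h
      · omega
      · have := hl.1 x h; omega
    have hyl : y ∈ l := by
      rcases List.mem_cons.1 hy with h | h
      · exact absurd h hyb
      · exact h
    rw [List.erase_cons_tail (by simpa using fun e => hyb e.symm)]
    by_cases e : x = b
    · subst e
      rw [List.erase_cons_head]
      cases l with
      | nil => simp at hyl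
      | cons c l => exact List.Lex.rel (hl.1 c (by simp))
    · rw [List.erase_cons_tail (by simpa using fun h => e h.symm)]
      apply List.Lex.cons
      exact ih hl.2 x ((List.mem_cons.1 hx).resolve_left e) y hyl hxy

theorem sort_erase (J : Finset ℕ) (x : ℕ) :
    (J.erase x).sort (· ≤ ·) = (J.sort (· ≤ ·)).erase x := by
  apply List.Perm.eq_of_pairwise' (r := (· ≤ ·))
  · exact Finset.pairwise_sort _ _
  · exact (Finset.pairwise_sort J (· ≤ ·)).sublist List.erase_sublist
  · rw [List.perm_ext_iff_of_nodup (Finset.sort_nodup _ _) ((Finset.sort_nodup J _).erase x)]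
    intro a
    rw [(Finset.sort_nodup J _).mem_erase_iff]
    simp

theorem lex_iff {J : Finset ℕ} {x y : ℕ} (hx : x ∈ J) (hy : y ∈ J)
    (h : lexLtN (J.erase x) (J.erase y)) : y < x := by
  unfold lexLtN at h
  rcases lt_trichotomy x y with c | c | c
  · exfalso
    have h2 := lex_erase (J.sort (· ≤ ·)) (Finset.sortedLT_sort J).pairwise x
      (by simpa using hx) y (by simpa using hy) c
    rw [sort_erase, sort_erase] at h
    exact asymm h h2
  · subst c
    exact (irrefl _ h).elim
  · exact c

theorem erase_of_sub {J Y : Finset ℕ} {d : ℕ} (hc : J.card = d + 2) (h : Y ⊆ J)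
    (hY : Y.card = d + 1) : ∃ x ∈ J, Y = J.erase x := by
  have : (J \ Y).card = 1 := by rw [Finset.card_sdiff_of_subset h]; omega
  obtain ⟨x, hx⟩ := Finset.card_eq_one.1 this
  have hxm : x ∈ J \ Y := by rw [hx]; simp
  refine ⟨x, (Finset.mem_sdiff.1 hxm).1, ?_⟩
  rw [Finset.erase_eq, ← hx, Finset.sdiff_sdiff_eq_self h]

theorem final3 (n d : ℕ) (I' I : Set (Finset ℕ)) (r : Finset ℕ → ℕ) (M' M : ℕ)
    (hI' : ∀ X ∈ I', X ⊆ Finset.Icc 1 (n-1) ∧ X.card = d + 1)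
    (hI : ∀ X ∈ I, X ⊆ Finset.Icc 1 (n-1) ∧ X.card = d + 1)
    (o : Orient (n-1) d r)
    (ht : ∀ X : Finset ℕ, X ⊆ Finset.Icc 1 (n-1) → X.card = d + 1 →
      (X ∈ I' ↔ r X < M') ∧ (X ∈ I ↔ r X < M)) :
    ∃ rank : Finset ℕ → ℕ,
      (∀ Y, Y ⊆ Finset.Icc 1 (n - 1) → Y.card = d + 1 →
        ∀ Z, Z ⊆ Finset.Icc 1 (n - 1) → Z.card = d + 1 →
          rank Y = rank Z → Y = Z) ∧
      AdmissibleN n d rank ∧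
      ∃ m m' : ℕ,
        I' = {X : Finset ℕ | X ⊆ Finset.Icc 1 (n - 1) ∧ X.card = d + 1 ∧ rank X < m'} ∧
        I = {X : Finset ℕ | X ⊆ Finset.Icc 1 (n - 1) ∧ X.card = d + 1 ∧ rank X < m} := by
  obtain ⟨K, hK⟩ := bdd (n-1) (fun X => Encodable.encode X)
  have lt : ∀ X Y : Finset ℕ, X ⊆ Finset.Icc 1 (n-1) → r X < r Y →
      r X * K + Encodable.encode X < r Y * K + Encodable.encode Y := by
    intro X Y hX h
    have := hK X hX
    have : (r X + 1) * K ≤ r Y * K := Nat.mul_le_mul_right K h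
    rw [add_mul] at this
    omega
  have thr : ∀ (X : Finset ℕ) (m : ℕ), X ⊆ Finset.Icc 1 (n-1) →
      (r X * K + Encodable.encode X < m * K ↔ r X < m) := by
    intro X m hX
    have := hK X hX
    constructor
    · intro h
      by_contra hc
      have : m * K ≤ r X * K := Nat.mul_le_mul_right K (not_lt.1 hc)
      omega
    · intro h
      have : (r X + 1) * K ≤ m * K := Nat.mul_le_mul_right K h
      rw [add_mul] at this
      omega
  refine ⟨fun X => r X * K + Encodable.encode X, ?_, ?_, M * K, M' * K, ?_, ?_⟩
  · intro Y hY _ Z hZ _ h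
    simp only [] at h
    rcases lt_trichotomy (r Y) (r Z) with c | c | c
    · have := lt Y Z hY c; omega
    · rw [c] at h
      exact Encodable.encode_injective (by omega)
    · have := lt Z Y hZ c; omega
  · intro J hJ hc
    have er : ∀ x, J.erase x ⊆ Finset.Icc 1 (n-1) := fun x => (Finset.erase_subset _ _).trans hJ
    rcases o J hJ hc with h | h
    · left
      intro Y hY hYc Z hZ hZc hl
      obtain ⟨x, hx, rfl⟩ := erase_of_sub hc hY hYc
      obtain ⟨y, hy, rfl⟩ := erase_of_sub hc hZ hZc
      exact lt _ _ (er x) (h y hy x hx (lex_iff hx hy hl))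
    · right
      intro Y hY hYc Z hZ hZc hl
      obtain ⟨x, hx, rfl⟩ := erase_of_sub hc hY hYc
      obtain ⟨y, hy, rfl⟩ := erase_of_sub hc hZ hZc
      exact lt _ _ (er y) (h y hy x hx (lex_iff hx hy hl))
  · ext X
    constructor
    · intro h
      have := hI' X h
      exact ⟨this.1, this.2, (thr X M' this.1).2 ((ht X this.1 this.2).1.1 h)⟩
    · rintro ⟨h1, h2, h3⟩
      exact (ht X h1 h2).1.2 ((thr X M' h1).1 h3)
  · ext X
    constructor
    · intro h
      have := hI X h
      exact ⟨this.1, this.2, (thr X M this.1).2 ((ht X this.1 this.2).2.1 h)⟩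
    · rintro ⟨h1, h2, h3⟩
      exact (ht X h1 h2).2.2 ((thr X M h1).1 h3)

def slotF {d : ℕ} (b : Fin (d + 1) → ℕ) (p : ℕ) : ℕ :=
  (Finset.univ.filter (fun i => b i ≤ p)).card

theorem slot_iff {d : ℕ} {b : Fin (d + 1) → ℕ} (hb : StrictMono b) (p : ℕ) (i : Fin (d + 1)) :
    i.val < slotF b p ↔ b i ≤ p := by
  constructor
  · intro h
    by_contra hc
    have : (Finset.univ.filter (fun i => b i ≤ p)) ⊆ Finset.Iio i := by
      intro j hj
      simp only [Finset.mem_filter, Finset.mem_univ, true_and] at hj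
      rw [Finset.mem_Iio]
      by_contra hji
      have := hb.monotone (not_lt.1 hji)
      omega
    have := Finset.card_le_card this
    rw [Fin.card_Iio] at this
    unfold slotF at h
    omega
  · intro h
    have : Finset.Iic i ⊆ (Finset.univ.filter (fun i => b i ≤ p)) := by
      intro j hj
      simp only [Finset.mem_filter, Finset.mem_univ, true_and]
      exact (hb.monotone (Finset.mem_Iic.1 hj)).trans h
    have := Finset.card_le_card this
    rw [Fin.card_Iic] at this
    unfold slotF
    omega

theorem slot_le {d : ℕ} (b : Fin (d + 1) → ℕ) (p : ℕ) : slotF b p ≤ d + 1 := by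
  unfold slotF
  exact (Finset.card_le_univ _).trans (by simp)

theorem slot_mono {d : ℕ} (b : Fin (d + 1) → ℕ) : Monotone (slotF b) := by
  intro p q h
  apply Finset.card_le_card
  intro j hj
  simp only [Finset.mem_filter, Finset.mem_univ, true_and] at hj ⊢
  omega

theorem slot_char {d : ℕ} {b : Fin (d + 1) → ℕ} (hb : StrictMono b) (p : ℕ) (t : ℕ)
    (ht : t ≤ d + 1) (h : ∀ k : Fin (d + 1), b k ≤ p ↔ k.val < t) : slotF b p = t := by
  have hs := slot_le b p
  by_contra hne
  have hlt : min (slotF b p) t < d + 1 := by omega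
  have h1 := slot_iff hb p ⟨_, hlt⟩
  have h2 := h ⟨_, hlt⟩
  rw [← h1] at h2
  simp only [] at h2
  omega

theorem slot_eq {d : ℕ} {b : Fin (d + 1) → ℕ} (hb : StrictMono b) (p : ℕ) (i : Fin d) :
    slotF b p = i.val + 1 ↔ b i.castSucc ≤ p ∧ p + 1 ≤ b i.succ := by
  have h1 := slot_iff hb p i.castSucc
  have h2 := slot_iff hb p i.succ
  simp only [Fin.val_castSucc, Fin.val_succ] at h1 h2
  omega

def ys (d : ℕ) (y : ℕ → ℕ) : Finset ℕ := (Finset.Icc 1 d).image y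

theorem ys_univ (d : ℕ) (y : ℕ → ℕ) :
    ys d y = Finset.image (fun i : Fin d => y (i.val + 1)) Finset.univ := by
  ext p
  simp only [ys, Finset.mem_image, Finset.mem_Icc, Finset.mem_univ, true_and]
  constructor
  · rintro ⟨k, hk, rfl⟩
    exact ⟨⟨k - 1, by omega⟩, by congr 1; simp; omega⟩
  · rintro ⟨i, rfl⟩
    exact ⟨i.val + 1, by omega, rfl⟩

theorem mem_rect {N d : ℕ} {b : Fin (d + 1) → ℕ} (hb : StrictMono b) {y : ℕ → ℕ} (h : VV N d y) :
    ys d y ∈ snugRect b ↔ ∀ k, 1 ≤ k → k ≤ d → slotF b (y k) = k := by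
  rw [ys_univ]
  constructor
  · rintro ⟨z, hz, e⟩
    have hzm : StrictMono z := by
      intro i j hij
      have h1 := (hz i).2
      have h2 := (hz j).1
      have h3 : b i.succ ≤ b j.castSucc := hb.monotone (by
        rw [Fin.le_def]; simp; exact hij)
      omega
    have hym : StrictMono (fun i : Fin d => y (i.val + 1)) := by
      intro i j hij
      exact h.1 _ _ (by omega) (by have : i.val < j.val := hij; omega) (by omega)
    have hr : Set.range (fun i : Fin d => y (i.val + 1)) = Set.range z := by
      have := congrArg (fun s : Finset ℕ => (s : Set ℕ)) e
      simpa using this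
    have := (StrictMono.range_inj hym hzm).1 hr
    intro k h1 h2
    have e1 := congrFun this ⟨k - 1, by omega⟩
    have hz' := hz ⟨k - 1, by omega⟩
    rw [← e1, ← slot_eq hb] at hz'
    simp only [Nat.sub_add_cancel h1] at hz'
    exact hz'
  · intro hk
    refine ⟨_, ?_, rfl⟩
    intro i
    exact (slot_eq hb _ i).1 (hk _ (by omega) (by omega))

theorem ys_sub {N d : ℕ} {y : ℕ → ℕ} (h : VV N d y) : ys d y ⊆ Finset.Icc 1 N := by
  intro p hp
  simp only [ys, Finset.mem_image, Finset.mem_Icc] at hp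
  obtain ⟨k, hk, rfl⟩ := hp
  exact Finset.mem_Icc.2 (h.2 k hk.1 hk.2)

theorem VV.inj {N d : ℕ} {y : ℕ → ℕ} (h : VV N d y) {i j : ℕ} (hi : 1 ≤ i) (hi' : i ≤ d)
    (hj : 1 ≤ j) (hj' : j ≤ d) (e : y i = y j) : i = j := by
  rcases lt_trichotomy i j with c | c | c
  · have := h.1 i j hi c hj'; omega
  · exact c
  · have := h.1 j i hj c hi'; omega

theorem ys_card {N d : ℕ} {y : ℕ → ℕ} (h : VV N d y) : (ys d y).card = d := by
  unfold ys
  rw [Finset.card_image_of_injOn]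
  · simp
  · intro i hi j hj e
    simp only [Finset.coe_Icc, Set.mem_Icc] at hi hj
    exact h.inj hi.1 hi.2 hj.1 hj.2 e

noncomputable def blk (W : Set (Set (Finset ℕ))) (Y : Finset ℕ) : Set (Finset ℕ) :=
  Classical.epsilon (fun B => B ∈ W ∧ Y ∈ B)

noncomputable def Phi (d : ℕ) (W : Set (Set (Finset ℕ))) (par : Set (Finset ℕ) → Fin (d + 1) → ℕ)
    (y : ℕ → ℕ) : ℕ → ℕ := slotF (par (blk W (ys d y)))

section
variable {n d : ℕ} {W : Set (Set (Finset ℕ))} {par : Set (Finset ℕ) → Fin (d + 1) → ℕ}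

theorem blk_spec (hW : SnugPartition n d W) {y : ℕ → ℕ} (h : VV (n-1) d y) :
    blk W (ys d y) ∈ W ∧ ys d y ∈ blk W (ys d y) := by
  obtain ⟨B, hB, _⟩ := hW.2 (ys d y) (ys_sub h) (ys_card h)
  exact Classical.epsilon_spec (p := fun B => B ∈ W ∧ ys d y ∈ B) ⟨B, hB⟩

theorem blk_eq (hW : SnugPartition n d W) {y : ℕ → ℕ} (h : VV (n-1) d y) {B : Set (Finset ℕ)}
    (hB : B ∈ W) (hy : ys d y ∈ B) : blk W (ys d y) = B :=
  (hW.2 (ys d y) (ys_sub h) (ys_card h)).unique (blk_spec hW h) ⟨hB, hy⟩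

theorem Phi_mem (hW : SnugPartition n d W)
    (hp : ∀ B ∈ W, StrictMono (par B) ∧ B = snugRect (par B)) {y z : ℕ → ℕ}
    (hy : VV (n-1) d y) (hz : VV (n-1) d z) :
    ys d z ∈ blk W (ys d y) ↔ ∀ k, 1 ≤ k → k ≤ d → Phi d W par y (z k) = k := by
  have hb := hp _ (blk_spec hW hy).1
  unfold Phi
  rw [← mem_rect hb.1 hz, ← hb.2]

theorem Phi_sys (hW : SnugPartition n d W)
    (hp : ∀ B ∈ W, StrictMono (par B) ∧ B = snugRect (par B)) :
    Sys (n-1) d (Phi d W par) := by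
  constructor
  · intro y _; exact slot_mono _
  · intro y h
    rw [← Phi_mem hW hp h h]
    exact (blk_spec hW h).2
  · intro y z hy hz h
    rw [← Phi_mem hW hp hy hz] at h
    unfold Phi
    rw [blk_eq hW hz (blk_spec hW hy).1 h]

theorem Phi_same (hW : SnugPartition n d W)
    (hp : ∀ B ∈ W, StrictMono (par B) ∧ B = snugRect (par B)) {y z : ℕ → ℕ}
    (hy : VV (n-1) d y) (hz : VV (n-1) d z) :
    SameBlock W (ys d y) (ys d z) ↔ Phi d W par y = Phi d W par z := by
  constructor
  · rintro ⟨B, hB, h1, h2⟩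
    unfold Phi
    rw [blk_eq hW hy hB h1, blk_eq hW hz hB h2]
  · intro e
    refine ⟨_, (blk_spec hW hy).1, (blk_spec hW hy).2, ?_⟩
    rw [Phi_mem hW hp hy hz, e]
    exact (Phi_sys hW hp).val z hz

end

def alf (d : ℕ) (a : ℕ → ℕ) (p : ℕ) : ℕ := ((Finset.Icc 1 (d + 2)).filter (fun k => a k ≤ p)).card

theorem alf_mono (d : ℕ) (a : ℕ → ℕ) : Monotone (alf d a) := by
  intro p q h
  apply Finset.card_le_card
  intro j hj
  simp only [Finset.mem_filter] at hj ⊢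
  exact ⟨hj.1, by omega⟩

theorem alf_le (d : ℕ) (a : ℕ → ℕ) (p : ℕ) : alf d a p ≤ d + 2 := by
  unfold alf
  exact (Finset.card_filter_le _ _).trans (by simp)

theorem alf_iff {d : ℕ} {a : ℕ → ℕ} (ha : ∀ i j, 1 ≤ i → i < j → j ≤ d + 2 → a i < a j)
    (p : ℕ) {k : ℕ} (h1 : 1 ≤ k) (h2 : k ≤ d + 2) : a k ≤ p ↔ k ≤ alf d a p := by
  constructor
  · intro h
    have : Finset.Icc 1 k ⊆ (Finset.Icc 1 (d + 2)).filter (fun k => a k ≤ p) := by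
      intro j hj
      rw [Finset.mem_Icc] at hj
      rw [Finset.mem_filter, Finset.mem_Icc]
      refine ⟨by omega, ?_⟩
      rcases eq_or_lt_of_le hj.2 with e | e
      · rw [e]; exact h
      · have := ha j k hj.1 e h2; omega
    have := Finset.card_le_card this
    rw [Nat.card_Icc] at this
    unfold alf
    omega
  · intro h
    by_contra hc
    have : (Finset.Icc 1 (d + 2)).filter (fun k => a k ≤ p) ⊆ Finset.Icc 1 (k-1) := by
      intro j hj
      rw [Finset.mem_filter, Finset.mem_Icc] at hj
      rw [Finset.mem_Icc]
      refine ⟨hj.1.1, ?_⟩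
      by_contra hjk
      rcases eq_or_lt_of_le (by omega : k ≤ j) with e | e
      · rw [e] at hc; omega
      · have := ha k j h1 e hj.1.2; omega
    have := Finset.card_le_card this
    rw [Nat.card_Icc] at this
    unfold alf at h
    omega

section
variable {d : ℕ} {a : ℕ → ℕ}

theorem omit_mono (ha : ∀ i j, 1 ≤ i → i < j → j ≤ d + 2 → a i < a j) (i : ℕ) :
    StrictMono (aOmit d a i) := by
  intro k l hkl
  have h : k.val < l.val := hkl
  have := l.isLt
  unfold aOmit
  split_ifs <;> apply ha <;> omega

theorem omit_slot (ha : ∀ i j, 1 ≤ i → i < j → j ≤ d + 2 → a i < a j) {i : ℕ} (h1 : 1 ≤ i)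
    (h2 : i ≤ d + 2) (p : ℕ) :
    slotF (aOmit d a i) p = if alf d a p < i then alf d a p else alf d a p - 1 := by
  have hl := alf_le d a p
  apply slot_char (omit_mono ha i)
  · split_ifs <;> omega
  · intro k
    have hk := k.isLt
    unfold aOmit
    by_cases c : k.val + 1 < i
    · rw [if_pos c, alf_iff ha p (by omega) (by omega)]
      split_ifs <;> omega
    · rw [if_neg c, alf_iff ha p (by omega) (by omega)]
      split_ifs <;> omega

theorem omit_R {N : ℕ} (ha : ∀ i j, 1 ≤ i → i < j → j ≤ d + 2 → a i < a j) {i : ℕ} (h1 : 1 ≤ i)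
    (h2 : i ≤ d + 2) {y : ℕ → ℕ} (hy : VV N d y) (hm : ys d y ∈ snugRect (aOmit d a i)) :
    (∀ k, 1 ≤ k → k ≤ d → 1 ≤ alf d a (y k) ∧ alf d a (y k) ≤ d + 1) ∧
    ∀ i j, 1 ≤ i → i < j → j ≤ d → alf d a (y i) < alf d a (y j) := by
  rw [mem_rect (omit_mono ha i) hy] at hm
  have hm' : ∀ k, 1 ≤ k → k ≤ d → (alf d a (y k) < i ∧ alf d a (y k) = k) ∨
      (i ≤ alf d a (y k) ∧ alf d a (y k) = k + 1) := by
    intro k hk hk'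
    have := hm k hk hk'
    rw [omit_slot ha h1 h2] at this
    split_ifs at this <;> omega
  constructor
  · intro k hk hk'
    have := hm' k hk hk'
    omega
  · intro k l hk hkl hl
    have := hm' k hk (by omega)
    have := hm' l (by omega) hl
    omega

theorem find_m {g : ℕ → ℕ} (h1 : ∀ k, 1 ≤ k → k ≤ d → 1 ≤ g k ∧ g k ≤ d + 1)
    (h2 : ∀ i j, 1 ≤ i → i < j → j ≤ d → g i < g j) :
    ∃ m, 1 ≤ m ∧ m ≤ d + 1 ∧ ∀ k, 1 ≤ k → k ≤ d → (k < m ∧ g k = k) ∨ (m ≤ k ∧ g k = k + 1) := by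
  by_cases hd : d = 0
  · exact ⟨1, le_rfl, by omega, by intro k _ _; omega⟩
  have r1 := rank_lem (d := d) (g := g) (h1 1 le_rfl (by omega)).1
    (fun k hk hk' => h2 k (k+1) hk (by omega) (by omega))
  have r2 := rank_lem2 (d := d) (e := 1) (g := g) (h1 d (by omega) le_rfl).2
    (fun k hk hk' => h2 k (k+1) hk (by omega) (by omega))
  classical
  by_cases ex : ∃ m, 1 ≤ m ∧ m ≤ d ∧ g m = m + 1
  · refine ⟨Nat.find ex, (Nat.find_spec ex).1, by have := (Nat.find_spec ex).2.1; omega, ?_⟩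
    have sp := Nat.find_spec ex
    have mn : ∀ k, k < Nat.find ex → ¬ (1 ≤ k ∧ k ≤ d ∧ g k = k + 1) := fun k hk => Nat.find_min ex hk
    generalize Nat.find ex = m at sp mn
    intro k hk hk'
    have a1 := r1 k hk hk'
    have a2 := r2 k hk hk'
    rcases lt_or_ge k m with c | c
    · have := mn k c; omega
    · right
      refine ⟨c, ?_⟩
      induction k, c using Nat.le_induction with
      | base => exact sp.2.2
      | succ k hmk ih =>
        have i1 := ih (by omega) (by omega) (r1 k (by omega) (by omega)) (r2 k (by omega) (by omega))
        have i2 := h2 k (k+1) (by omega) (by omega) hk'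
        omega
  · refine ⟨d + 1, by omega, le_rfl, ?_⟩
    intro k hk hk'
    have a1 := r1 k hk hk'
    have a2 := r2 k hk hk'
    left
    refine ⟨by omega, ?_⟩
    by_contra hne
    exact ex ⟨k, hk, hk', by omega⟩

open Classical in
/-- parameters of the blocks, preferring the `aOmit` parameters of a given parity -/
noncomputable def parr (d : ℕ) (a : ℕ → ℕ) (q : ℕ → Prop) (B : Set (Finset ℕ)) : Fin (d + 1) → ℕ :=
  if ∃ i, 1 ≤ i ∧ i ≤ d + 2 ∧ q i ∧ B = snugRect (aOmit d a i) then
    aOmit d a (Classical.epsilon (fun i => 1 ≤ i ∧ i ≤ d + 2 ∧ q i ∧ B = snugRect (aOmit d a i)))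
  else Classical.epsilon (fun b => StrictMono b ∧ B = snugRect b)

theorem parr_pos {q : ℕ → Prop} {B : Set (Finset ℕ)}
    (h : ∃ i, 1 ≤ i ∧ i ≤ d + 2 ∧ q i ∧ B = snugRect (aOmit d a i)) :
    ∃ i, 1 ≤ i ∧ i ≤ d + 2 ∧ q i ∧ B = snugRect (aOmit d a i) ∧ parr d a q B = aOmit d a i := by
  have := Classical.epsilon_spec h
  refine ⟨_, this.1, this.2.1, this.2.2.1, this.2.2.2, ?_⟩
  unfold parr
  rw [if_pos h]

theorem parr_neg {q : ℕ → Prop} {B : Set (Finset ℕ)}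
    (h : ¬ ∃ i, 1 ≤ i ∧ i ≤ d + 2 ∧ q i ∧ B = snugRect (aOmit d a i)) :
    parr d a q B = Classical.epsilon (fun b => StrictMono b ∧ B = snugRect b) := by
  unfold parr
  rw [if_neg h]

theorem parr_spec {n : ℕ} {W : Set (Set (Finset ℕ))} (hW : SnugPartition n d W)
    (ha : ∀ i j, 1 ≤ i → i < j → j ≤ d + 2 → a i < a j) (q : ℕ → Prop) :
    ∀ B ∈ W, StrictMono (parr d a q B) ∧ B = snugRect (parr d a q B) := by
  intro B hB
  by_cases c : ∃ i, 1 ≤ i ∧ i ≤ d + 2 ∧ q i ∧ B = snugRect (aOmit d a i)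
  · obtain ⟨i, _, _, _, h, e⟩ := parr_pos c
    rw [e]
    exact ⟨omit_mono ha i, h⟩
  · rw [parr_neg c]
    obtain ⟨b, hb, _, e⟩ := hW.1 B hB
    exact Classical.epsilon_spec (p := fun b => StrictMono b ∧ B = snugRect b) ⟨b, hb, e⟩

theorem Phi_R {n : ℕ} {W W₀ : Set (Set (Finset ℕ))} (hW : SnugPartition n d W)
    (ha : ∀ i j, 1 ≤ i → i < j → j ≤ d + 2 → a i < a j) (q : ℕ → Prop)
    (hq : ∀ i, q i ∨ q (i + 1))
    (hWeq : W = W₀ ∪ {B | ∃ i, 1 ≤ i ∧ i ≤ d + 2 ∧ q i ∧ B = snugRect (aOmit d a i)})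
    {y : ℕ → ℕ} (hy : VV (n-1) d y)
    (h1 : ∀ k, 1 ≤ k → k ≤ d → 1 ≤ alf d a (y k) ∧ alf d a (y k) ≤ d + 1)
    (h2 : ∀ i j, 1 ≤ i → i < j → j ≤ d → alf d a (y i) < alf d a (y j)) :
    ∃ i, 1 ≤ i ∧ i ≤ d + 2 ∧ q i ∧ ∀ p, Phi d W (parr d a q) y p =
      if alf d a p < i then alf d a p else alf d a p - 1 := by
  obtain ⟨m, hm1, hm2, hm⟩ := find_m (g := fun k => alf d a (y k)) h1 h2
  have main : ∀ i, (i = m ∨ i = m + 1) → q i → 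
    ∃ i, 1 ≤ i ∧ i ≤ d + 2 ∧ q i ∧ ∀ p, Phi d W (parr d a q) y p =
      if alf d a p < i then alf d a p else alf d a p - 1 := by
    intro i hi hqi
    have hmem : ys d y ∈ snugRect (aOmit d a i) := by
      rw [mem_rect (omit_mono ha i) hy]
      intro k hk hk'
      rw [omit_slot ha (by omega) (by omega)]
      have := hm k hk hk'
      split_ifs <;> omega
    have hin : snugRect (aOmit d a i) ∈ W := by
      rw [hWeq]; right
      exact ⟨i, by omega, by omega, hqi, rfl⟩
    have hblk := blk_eq hW hy hin hmem
    obtain ⟨i', g1, g2, g3, g4, g5⟩ := parr_pos (d := d) (a := a) (q := q)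
      (B := snugRect (aOmit d a i)) ⟨i, by omega, by omega, hqi, rfl⟩
    refine ⟨i', g1, g2, g3, ?_⟩
    intro p
    unfold Phi
    rw [hblk, g5, omit_slot ha g1 g2]
  rcases hq m with h | h
  · exact main m (Or.inl rfl) h
  · exact main (m+1) (Or.inr rfl) h

theorem Phi_nR {n : ℕ} {W W₀ : Set (Set (Finset ℕ))} (hW : SnugPartition n d W)
    (ha : ∀ i j, 1 ≤ i → i < j → j ≤ d + 2 → a i < a j) (q : ℕ → Prop)
    (hWeq : W = W₀ ∪ {B | ∃ i, 1 ≤ i ∧ i ≤ d + 2 ∧ q i ∧ B = snugRect (aOmit d a i)})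
    {y : ℕ → ℕ} (hy : VV (n-1) d y)
    (h : ¬ ((∀ k, 1 ≤ k → k ≤ d → 1 ≤ alf d a (y k) ∧ alf d a (y k) ≤ d + 1) ∧
      ∀ i j, 1 ≤ i → i < j → j ≤ d → alf d a (y i) < alf d a (y j))) :
    blk W (ys d y) ∈ W₀ ∧ Phi d W (parr d a q) y =
      slotF (Classical.epsilon (fun b : Fin (d + 1) → ℕ => StrictMono b ∧ blk W (ys d y) = snugRect b)) := by
  have sp := blk_spec hW hy
  have no : ¬ ∃ i, 1 ≤ i ∧ i ≤ d + 2 ∧ q i ∧ blk W (ys d y) = snugRect (aOmit d a i) := by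
    rintro ⟨i, h1, h2, _, h4⟩
    have := sp.2
    rw [h4] at this
    exact h (omit_R ha h1 h2 hy this)
  constructor
  · rcases (Set.ext_iff.1 hWeq _).1 sp.1 with h | h
    · exact h
    · exact absurd h no
  · unfold Phi
    rw [parr_neg no]

theorem Phi_dsys {n : ℕ} {W W' W₀ : Set (Set (Finset ℕ))} (hW : SnugPartition n d W)
    (hW' : SnugPartition n d W')
    (ha : ∀ i j, 1 ≤ i → i < j → j ≤ d + 2 → a i < a j)
    (hWeq : W = W₀ ∪ {B | ∃ i, 1 ≤ i ∧ i ≤ d + 2 ∧ i % 2 ≠ d % 2 ∧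
      B = snugRect (aOmit d a i)})
    (hW'eq : W' = W₀ ∪ {B | ∃ i, 1 ≤ i ∧ i ≤ d + 2 ∧ i % 2 = d % 2 ∧
      B = snugRect (aOmit d a i)}) :
    DSys (n-1) d (Phi d W (parr d a (fun i => i % 2 ≠ d % 2)))
      (Phi d W' (parr d a (fun i => i % 2 = d % 2))) (alf d a) := by
  constructor
  · exact alf_mono d a
  · intro y hy h
    have e1 := Phi_nR hW ha _ hWeq hy h
    have e2 := Phi_nR hW' ha _ hW'eq hy h
    rw [e1.2, e2.2]
    have : blk W' (ys d y) = blk W (ys d y) := by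
      apply blk_eq hW' hy
      · rw [hW'eq]; left; exact e1.1
      · exact (blk_spec hW hy).2
    rw [this]
  · intro y hy h1 h2 p q hpq
    obtain ⟨i, _, _, _, e⟩ := Phi_R hW ha _ (by intro i; omega) hWeq hy h1 h2
    obtain ⟨i', _, _, _, e'⟩ := Phi_R hW' ha _ (by intro i; omega) hW'eq hy h1 h2
    rw [e, e, e', e', hpq]
    exact ⟨rfl, rfl⟩
  · intro y hy h p hp
    have h1 : ∀ k, 1 ≤ k → k ≤ d → 1 ≤ alf d a (y k) ∧ alf d a (y k) ≤ d + 1 := by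
      intro k hk hk'; rw [h k hk hk']; omega
    have h2 : ∀ i j, 1 ≤ i → i < j → j ≤ d → alf d a (y i) < alf d a (y j) := by
      intro i j hi hij hj
      rw [h i hi (by omega), h j (by omega) hj]; exact hij
    obtain ⟨i, i1, i2, i3, e⟩ := Phi_R hW ha _ (by intro i; omega) hWeq hy h1 h2
    obtain ⟨i', j1, j2, j3, e'⟩ := Phi_R hW' ha _ (by intro i; omega) hW'eq hy h1 h2
    have key : ∀ k, 1 ≤ k → k ≤ d → k < i ∧ k < i' := by
      intro k hk hk'
      have v1 := (Phi_sys hW (parr_spec hW ha (fun i => i % 2 ≠ d % 2))).val y hy k hk hk'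
      have v2 := (Phi_sys hW' (parr_spec hW' ha (fun i => i % 2 = d % 2))).val y hy k hk hk'
      rw [e, h k hk hk'] at v1
      rw [e', h k hk hk'] at v2
      constructor
      · split_ifs at v1 <;> omega
      · split_ifs at v2 <;> omega
    rw [e, e', hp]
    have hii : d < i ∧ d < i' := by
      rcases Nat.eq_zero_or_pos d with c | c
      · omega
      · exact key d c le_rfl
    constructor <;> split_ifs <;> omega

end

theorem exists_VV {N k : ℕ} {X : Finset ℕ} (hX : X ⊆ Finset.Icc 1 N) (hc : X.card = k) :
    ∃ x, VV N k x ∧ X = ys k x := by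
  have hx : ∀ i (h : i < k), (fun i => if h : i - 1 < k then X.orderEmbOfFin hc ⟨i - 1, h⟩ else 0) (i + 1)
      = X.orderEmbOfFin hc ⟨i, h⟩ := by
    intro i h
    simp [h]
  generalize hxx : (fun i => if h : i - 1 < k then X.orderEmbOfFin hc ⟨i - 1, h⟩ else 0) = x at hx
  have hx' : ∀ i (h1 : 1 ≤ i) (h : i ≤ k), x i = X.orderEmbOfFin hc ⟨i - 1, by omega⟩ := by
    intro i h1 h
    obtain ⟨t, rfl⟩ : ∃ t, i = t + 1 := ⟨i - 1, by omega⟩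
    exact hx t (by omega)
  refine ⟨x, ⟨?_, ?_⟩, ?_⟩
  · intro i j h1 h2 h3
    rw [hx' i h1 (by omega), hx' j (by omega) h3]
    apply (X.orderEmbOfFin hc).strictMono
    rw [Fin.lt_def]
    show i - 1 < j - 1
    omega
  · intro i h1 h2
    rw [hx' i h1 h2]
    exact Finset.mem_Icc.1 (hX (Finset.orderEmbOfFin_mem X hc _))
  · rw [ys_univ]
    have : (fun i : Fin k => x (i.val + 1)) = X.orderEmbOfFin hc := by
      funext i
      exact hx i.val i.isLt
    rw [this]
    apply Finset.coe_injective
    simp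

theorem mem_ys {k p : ℕ} {x : ℕ → ℕ} : p ∈ ys k x ↔ ∃ m, 1 ≤ m ∧ m ≤ k ∧ p = x m := by
  simp only [ys, Finset.mem_image, Finset.mem_Icc]
  constructor
  · rintro ⟨m, ⟨h1, h2⟩, h3⟩; exact ⟨m, h1, h2, h3.symm⟩
  · rintro ⟨m, h1, h2, h3⟩; exact ⟨m, ⟨h1, h2⟩, h3.symm⟩

theorem ys_erase {N k m : ℕ} {x : ℕ → ℕ} (h : VV N (k + 1) x) (h1 : 1 ≤ m) (h2 : m ≤ k + 1) :
    (ys (k + 1) x).erase (x m) = ys k (x ∘ skp m) := by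
  ext p
  rw [Finset.mem_erase, mem_ys, mem_ys]
  constructor
  · rintro ⟨hp, i, i1, i2, rfl⟩
    have hne : i ≠ m := fun e => hp (by rw [e])
    rcases lt_or_gt_of_ne hne with c | c
    · exact ⟨i, i1, by omega, by simp [skp, c]⟩
    · refine ⟨i - 1, by omega, by omega, ?_⟩
      have : ¬ (i - 1 < m) := by omega
      simp only [Function.comp, skp, this, if_false]
      congr 1; omega
  · rintro ⟨i, i1, i2, rfl⟩
    have b : 1 ≤ skp m i ∧ skp m i ≤ k + 1 ∧ skp m i ≠ m := by
      unfold skp; split_ifs <;> omega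
    refine ⟨?_, skp m i, b.1, b.2.1, rfl⟩
    intro e
    exact b.2.2 (h.inj b.1 b.2.1 h1 h2 e)

theorem ys_sup {N k : ℕ} {x : ℕ → ℕ} (h : VV N (k + 1) x) : (ys (k + 1) x).sup id = x (k + 1) := by
  apply le_antisymm
  · apply Finset.sup_le
    intro p hp
    obtain ⟨m, h1, h2, rfl⟩ := mem_ys.1 hp
    rcases eq_or_lt_of_le h2 with e | e
    · rw [e]; exact le_rfl
    · exact (h.1 m (k+1) h1 e le_rfl).le
  · exact Finset.le_sup (f := id) (mem_ys.2 ⟨k + 1, by omega, le_rfl, rfl⟩)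

theorem ys_unique {N k : ℕ} {x y : ℕ → ℕ} (hx : VV N k x) (hy : VV N k y) (e : ys k x = ys k y) :
    ∀ m, 1 ≤ m → m ≤ k → x m = y m := by
  have sm : ∀ z, VV N k z → StrictMono (fun i : Fin k => z (i.val + 1)) := by
    intro z h i j hij
    exact h.1 _ _ (by omega) (by have : i.val < j.val := hij; omega) (by omega)
  have hr : Set.range (fun i : Fin k => x (i.val + 1)) = Set.range (fun i : Fin k => y (i.val + 1)) := by
    rw [ys_univ, ys_univ] at e
    have := congrArg (fun s : Finset ℕ => (s : Set ℕ)) e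
    simpa using this
  have := (StrictMono.range_inj (sm x hx) (sm y hy)).1 hr
  intro m h1 h2
  have e1 := congrFun this ⟨m - 1, by omega⟩
  simp only [Nat.sub_add_cancel h1] at e1
  exact e1

section
variable {n d : ℕ} {W : Set (Set (Finset ℕ))} {par : Set (Finset ℕ) → Fin (d + 1) → ℕ}

theorem inv_iff (hd : 1 ≤ d) (hW : SnugPartition n d W)
    (hp : ∀ B ∈ W, StrictMono (par B) ∧ B = snugRect (par B)) {x : ℕ → ℕ}
    (h : VV (n-1) (d + 1) x) : ys (d + 1) x ∈ InvSetP n d W ↔ Adj (Phi d W par) x d := by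
  have e1 : (ys (d + 1) x).erase ((ys (d + 1) x).sup id) = ys d (x ∘ skp (d + 1)) := by
    rw [ys_sup h, ys_erase h (by omega) le_rfl]
  have e2 : (ys d (x ∘ skp (d + 1))).sup id = x d := by
    obtain ⟨e, rfl⟩ : ∃ e, d = e + 1 := ⟨d - 1, by omega⟩
    rw [ys_sup (VV_skp h _)]
    simp [skp]
  have : ys (d + 1) x ∈ InvSetP n d W ↔ SameBlock W (ys d (x ∘ skp (d + 1))) (ys d (x ∘ skp d)) := by
    show _ ∧ _ ∧ _ ↔ _
    rw [e1, e2, ys_erase h hd (by omega)]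
    exact ⟨fun h => h.2.2, fun h' => ⟨ys_sub h, ys_card h, h'⟩⟩
  rw [this, Phi_same hW hp (VV_skp h _) (VV_skp h _)]
  exact eq_comm

theorem inv_erase (hd : 1 ≤ d) (hW : SnugPartition n d W)
    (hp : ∀ B ∈ W, StrictMono (par B) ∧ B = snugRect (par B)) {j : ℕ → ℕ}
    (h : VV (n-1) (d + 2) j) {m : ℕ} (h1 : 1 ≤ m) (h2 : m ≤ d + 2) :
    (ys (d + 2) j).erase (j m) ∈ InvSetP n d W ↔ ff d (Phi d W par) j m := by
  rw [ys_erase h h1 h2, inv_iff hd hW hp (VV_skp h m)]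
  rfl

theorem VV.lt_iff {N k : ℕ} {j : ℕ → ℕ} (h : VV N k j) {p q : ℕ} (hp : 1 ≤ p) (hp' : p ≤ k)
    (hq : 1 ≤ q) (hq' : q ≤ k) : j p < j q ↔ p < q := by
  constructor
  · intro hlt
    by_contra hc
    rcases eq_or_lt_of_le (not_lt.1 hc) with e | e
    · rw [e] at hlt; omega
    · have := h.1 q p hq e hp'; omega
  · intro hlt
    exact h.1 p q hp hlt hq'

theorem inv_consis (hd : 2 ≤ d) (hW : SnugPartition n d W)
    (hp : ∀ B ∈ W, StrictMono (par B) ∧ B = snugRect (par B)) :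
    Consis (n-1) d (fun X => X ∈ InvSetP n d W) := by
  intro J hJ hc x hx y hy z hz hxy hyz
  obtain ⟨j, hj, rfl⟩ := exists_VV hJ hc
  obtain ⟨p, p1, p2, rfl⟩ := mem_ys.1 hx
  obtain ⟨q, q1, q2, rfl⟩ := mem_ys.1 hy
  obtain ⟨s, s1, s2, rfl⟩ := mem_ys.1 hz
  simp only []
  rw [inv_erase (by omega) hW hp hj p1 p2, inv_erase (by omega) hW hp hj q1 q2,
    inv_erase (by omega) hW hp hj s1 s2]
  rw [hj.lt_iff p1 p2 q1 q2] at hxy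
  rw [hj.lt_iff q1 q2 s1 s2] at hyz
  exact ff_cons (Phi_sys hW hp) hd hj p1 hxy hyz s2

end

def DD (N d : ℕ) (α : ℕ → ℕ) (X : Finset ℕ) : Prop :=
  ∃ x, VV N (d + 1) x ∧ X = ys (d + 1) x ∧ InD d α x

theorem DD_iff {N d : ℕ} {α : ℕ → ℕ} {x : ℕ → ℕ} (h : VV N (d + 1) x) :
    DD N d α (ys (d + 1) x) ↔ InD d α x := by
  constructor
  · rintro ⟨y, hy, e, hD⟩
    intro k h1 h2
    rw [ys_unique h hy e k h1 h2]
    exact hD k h1 h2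
  · intro hD
    exact ⟨x, h, rfl, hD⟩

theorem DD_erase {N d : ℕ} {α : ℕ → ℕ} {j : ℕ → ℕ} (h : VV N (d + 2) j) {m : ℕ} (h1 : 1 ≤ m)
    (h2 : m ≤ d + 2) : DD N d α ((ys (d + 2) j).erase (j m)) ↔ InD d α (j ∘ skp m) := by
  rw [ys_erase h h1 h2, DD_iff (VV_skp h m)]

theorem stmt_18 (d n : ℕ) (hd : 2 ≤ d) (hdn : d < n - 1)
    (a : ℕ → ℕ)
    (ha : ∀ i j, 1 ≤ i → i < j → j ≤ d + 2 → a i < a j)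
    (hab : ∀ i, 1 ≤ i → i ≤ d + 2 → 1 ≤ a i ∧ a i ≤ n)
    (W W' : Set (Set (Finset ℕ)))
    (hW : SnugPartition n d W) (hW' : SnugPartition n d W')
    (W₀ : Set (Set (Finset ℕ)))
    (hWeq : W = W₀ ∪ {B | ∃ i, 1 ≤ i ∧ i ≤ d + 2 ∧ i % 2 ≠ d % 2 ∧
      B = snugRect (aOmit d a i)})
    (hW'eq : W' = W₀ ∪ {B | ∃ i, 1 ≤ i ∧ i ≤ d + 2 ∧ i % 2 = d % 2 ∧
      B = snugRect (aOmit d a i)})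
    (hnew : ∀ i, 1 ≤ i → i ≤ d + 2 → snugRect (aOmit d a i) ∉ W₀) :
    ∃ rank : Finset ℕ → ℕ,
      (∀ Y, Y ⊆ Finset.Icc 1 (n - 1) → Y.card = d + 1 →
        ∀ Z, Z ⊆ Finset.Icc 1 (n - 1) → Z.card = d + 1 →
          rank Y = rank Z → Y = Z) ∧
      AdmissibleN n d rank ∧
      ∃ m m' : ℕ,
        InvSetP n d W' =
          {X : Finset ℕ | X ⊆ Finset.Icc 1 (n - 1) ∧ X.card = d + 1 ∧
            rank X < m'} ∧
        InvSetP n d W =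
          {X : Finset ℕ | X ⊆ Finset.Icc 1 (n - 1) ∧ X.card = d + 1 ∧
            rank X < m} := by
  classical
  have hp := parr_spec hW ha (fun i => i % 2 ≠ d % 2)
  have hp' := parr_spec hW' ha (fun i => i % 2 = d % 2)
  have S := Phi_sys hW hp
  have S' := Phi_sys hW' hp'
  have G := Phi_dsys hW hW' ha hWeq hW'eq
  have hd1 : 1 ≤ d := by omega
  obtain ⟨r, M', M, o, ht⟩ := combine (n-1) d (fun X => X ∈ InvSetP n d W')
    (fun X => X ∈ InvSetP n d W) (DD (n-1) d (alf d a))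
    (fun t => if Even (d + alf d a t) then t else n - t)
    (inv_consis hd hW' hp') (inv_consis hd hW hp)
    (by
      intro X hX hc hD
      obtain ⟨x, hx, rfl⟩ := exists_VV hX hc
      rw [DD_iff hx] at hD
      rw [inv_iff hd1 hW hp hx, inv_iff hd1 hW' hp' hx]
      exact D1 S S' G hd1 hx hD)
    (by
      intro X hX hc hD
      obtain ⟨x, hx, rfl⟩ := exists_VV hX hc
      rw [DD_iff hx] at hD
      rw [inv_iff hd1 hW hp hx, inv_iff hd1 hW' hp' hx]
      exact D1' S S' G hd1 hx hD)
    (by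
      intro J hJ hc u hu v hv huv hDu hDv
      obtain ⟨j, hj, rfl⟩ := exists_VV hJ hc
      obtain ⟨p, p1, p2, rfl⟩ := mem_ys.1 hu
      obtain ⟨q, q1, q2, rfl⟩ := mem_ys.1 hv
      rw [hj.lt_iff p1 p2 q1 q2] at huv
      rw [DD_erase hj p1 p2] at hDu
      rw [DD_erase hj q1 q2] at hDv
      obtain ⟨rfl, e⟩ := D2 p1 huv q2 hDu hDv
      have ep : alf d a (j p) = p := by rw [e p p1 p2]; simp
      have eq : alf d a (j (p+1)) = p := by rw [e (p+1) q1 q2]; simp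
      have l1 := hj.1 p (p+1) p1 (by omega) q2
      have l2 := hj.2 (p+1) q1 q2
      have w1 : ((if Even (d + p) then j p else n - j p) <
          (if Even (d + p) then j (p+1) else n - j (p+1))) ↔ Even (d + p) := by
        split_ifs with c
        · simp [c, l1]
        · simp only [c, iff_false]; omega
      have w2 : ((if Even (d + p) then j (p+1) else n - j (p+1)) <
          (if Even (d + p) then j p else n - j p)) ↔ ¬ Even (d + p) := by
        split_ifs with c
        · simp only [c, not_true_eq_false, iff_false]; omega
        · simp only [c, not_false_eq_true, iff_true]; omega
      simp only [ep, eq]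
      refine ⟨?_, ?_⟩
      · split_ifs <;> omega
      intro k hk hku hkv
      obtain ⟨l, m1, m2, rfl⟩ := mem_ys.1 hk
      have n1 : l ≠ p := fun h => hku (by rw [h])
      have n2 : l ≠ p + 1 := fun h => hkv (by rw [h])
      rw [DD_erase hj m1 m2, inv_erase hd1 hW hp hj m1 m2, w1, w2, hj.lt_iff q1 q2 m1 m2,
        hj.lt_iff m1 m2 p1 p2]
      rcases lt_or_gt_of_ne n1 with c | c
      · refine ⟨fun hD => ?_, Or.inr ⟨c, D4 S G hj m1 c q2 e⟩⟩
        have := (D2 m1 c p2 hD hDu).1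
        have := (D2 m1 (by omega) q2 hD hDv).1
        omega
      · refine ⟨fun hD => ?_, Or.inl ⟨by omega, D3 S G hj p1 (by omega) m2 e⟩⟩
        have := (D2 p1 c m2 hDu hD).1
        omega)
  exact final3 n d _ _ r M' M (fun X h => ⟨h.1, h.2.1⟩) (fun X h => ⟨h.1, h.2.1⟩) o ht
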